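/- arXiv:1301.2662 — 9 statements merged into one kernel-verified Lean document; each statement's English description precedes it below -/
import Mathlib

section
/- Assume player 1's information is semi-standard with partition {ℬ_i : i∈ℐ} of ℬ. Then for all y, y' ∈ 𝒴 one has H̄(y') = H̄(y) if and only if Σ_{b∈ℬ_i} y'[b] = Σ_{b∈ℬ_i} y[b] for every i ∈ ℐ; that is, the maximal informative mapping reveals exactly the total probabilities assigned to each cell of the partition. -/
open Finset

/-- with a semi-standard information structure for player 1 (partition of `ℬ`
into cells, encoded by a surjective cell map `c : ℬ → ℐ`, with `H̄` constant equal to `H̄ᵢ`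
on each cell and the `H̄ᵢ` linearly independent), two mixed actions `y, y' ∈ 𝒴` have the
same maximal informative signal `H̄` if and only if they assign the same total probability
to every cell. -/
theorem semistandard_signal_iff_cell_probabilities
    {A B I : Type*} [Fintype A] [Fintype B] [Fintype I] [DecidableEq I] {d : ℕ}
    (H : A → B → Fin d → ℝ)
    (c : B → I) (hc : Function.Surjective c)
    (Hi : I → A → Fin d → ℝ)
    (hcell : ∀ b, (fun a => H a b) = Hi (c b))
    (hind : LinearIndependent ℝ Hi)
    (y y' : B → ℝ) (hy : y ∈ stdSimplex ℝ B) (hy' : y' ∈ stdSimplex ℝ B) :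
    ((fun a j => ∑ b, y' b * H a b j) = fun a j => ∑ b, y b * H a b j) ↔
      ∀ i, ∑ b ∈ univ.filter (fun b => c b = i), y' b
         = ∑ b ∈ univ.filter (fun b => c b = i), y b := by
  have key : ∀ z : B → ℝ, (fun a j => ∑ b, z b * H a b j)
      = ∑ i, (∑ b ∈ univ.filter (fun b => c b = i), z b) • Hi i := by
    intro z
    have hfiber : ∑ i, (∑ b ∈ univ.filter (fun b => c b = i), z b) • Hi i
        = ∑ b, z b • Hi (c b) := by
      rw [← Finset.sum_fiberwise univ c (fun b => z b • Hi (c b))]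
      refine Finset.sum_congr rfl fun i _ => ?_
      rw [Finset.sum_smul]
      refine Finset.sum_congr rfl fun b hb => ?_
      rw [(Finset.mem_filter.mp hb).2]
    rw [hfiber]
    funext a j
    simp [← hcell, Finset.sum_apply]
  rw [key y', key y]
  constructor
  · intro h i
    have hzero := Fintype.linearIndependent_iff.mp hind
      (fun i => ∑ b ∈ univ.filter (fun b => c b = i), y' b
        - ∑ b ∈ univ.filter (fun b => c b = i), y b)
      (by simp only [sub_smul, Finset.sum_sub_distrib, h, sub_self]) i
    exact sub_eq_zero.mp hzero
  · intro h
    simp only [h]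
end

section
/- Assume player 1's information is semi-standard with partition {ℬ_i : i∈ℐ} of ℬ, and for each i ∈ ℐ set 𝒰_i = conv{(u(a,b))_{a∈𝒜} : b ∈ ℬ_i} ⊆ ℝ^𝒜. Then the uncertainty correspondence Φ is linear on 𝒴: for every y ∈ 𝒴, Φ(y) = Σ_{i∈ℐ} y_i 𝒰_i where y_i = Σ_{b∈ℬ_i} y[b]; equivalently, Φ(y) = Σ_{b∈ℬ} y[b] Φ(b) as weighted Minkowski sums. -/
open Finset

/-- The uncertainty correspondence `Φ`. -/
def Phi {A B : Type*} [Fintype A] [Fintype B] {d : ℕ} (u : A → B → ℝ)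
    (H : A → B → Fin d → ℝ) (y : B → ℝ) : Set (A → ℝ) :=
  {U | ∃ y' ∈ stdSimplex ℝ B, (∀ a j, ∑ b, y' b * H a b j = ∑ b, y b * H a b j) ∧
    U = fun a => ∑ b, y' b * u a b}

theorem convex_Phi {A B : Type*} [Fintype A] [Fintype B] {d : ℕ} (u : A → B → ℝ)
    (H : A → B → Fin d → ℝ) (y : B → ℝ) : Convex ℝ (Phi u H y) := by
  rintro _ ⟨v, hv, hvH, rfl⟩ _ ⟨w, hw, hwH, rfl⟩ s t hs ht hst
  have hlin (φ : B → ℝ) :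
      ∑ b, (s • v + t • w) b * φ b = s * ∑ b, v b * φ b + t * ∑ b, w b * φ b := by
    simp [add_mul, sum_add_distrib, mul_sum, mul_assoc]
  refine ⟨s • v + t • w, convex_stdSimplex ℝ B hv hw hs ht hst, fun a j => ?_, ?_⟩
  · rw [hlin, hvH, hwH, ← add_mul, hst, one_mul]
  · ext a
    exact (hlin (u a)).symm

theorem payoff_mem_Phi_single {A B : Type*} [Fintype A] [Fintype B] [DecidableEq B] {d : ℕ}
    (u : A → B → ℝ) (H : A → B → Fin d → ℝ) {b b₀ : B} (h : ∀ a, H a b = H a b₀) :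
    (fun a => u a b) ∈ Phi u H (fun b' => if b' = b₀ then (1 : ℝ) else 0) := by
  refine ⟨fun b' => if b' = b then 1 else 0, ⟨fun b' => ?_, by simp⟩, by simp [h], by simp⟩
  dsimp only
  split_ifs <;> simp

theorem sum_smul_mem_Phi {A B : Type*} [Fintype A] [Fintype B] [DecidableEq B] {d : ℕ}
    (u : A → B → ℝ) (H : A → B → Fin d → ℝ) {y : B → ℝ} (hy : y ∈ stdSimplex ℝ B)
    {g : B → A → ℝ} (hg : ∀ b, g b ∈ Phi u H (fun b' => if b' = b then (1 : ℝ) else 0)) :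
    ∑ b, y b • g b ∈ Phi u H y := by
  choose w hw hwH hwu using hg
  have hlin (φ : B → ℝ) :
      ∑ b', (∑ b, y b • w b) b' * φ b' = ∑ b, y b * ∑ b', w b b' * φ b' := by
    simp only [Finset.sum_apply, Pi.smul_apply, smul_eq_mul, sum_mul, mul_sum, mul_assoc]
    exact sum_comm
  refine ⟨∑ b, y b • w b, (convex_stdSimplex ℝ B).sum_mem (fun b _ => hy.1 b) hy.2
    (fun b _ => hw b), fun a j => ?_, ?_⟩
  · rw [hlin]
    simp [hwH]
  · ext a
    rw [hlin]
    simp [hwu]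

theorem cell_mass_eq_of_signal_eq {A B I : Type*} [Fintype B] [Fintype I]
    [DecidableEq I] {d : ℕ} {H : A → B → Fin d → ℝ} {c : B → I} {Hi : I → A → Fin d → ℝ}
    (hcell : ∀ b, (fun a => H a b) = Hi (c b)) (hind : LinearIndependent ℝ Hi) {y y' : B → ℝ}
    (h : ∀ a j, ∑ b, y' b * H a b j = ∑ b, y b * H a b j) (i : I) :
    ∑ b with c b = i, y' b = ∑ b with c b = i, y b := by
  have key (z : B → ℝ) (a : A) (j : Fin d) :
      ∑ i, (∑ b with c b = i, z b) * Hi i a j = ∑ b, z b * H a b j := by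
    rw [← sum_fiberwise univ c]
    refine sum_congr rfl fun i _ => ?_
    rw [sum_mul]
    refine sum_congr rfl fun b hb => ?_
    rw [← (mem_filter.1 hb).2, ← hcell]
  rw [← sub_eq_zero]
  refine Fintype.linearIndependent_iff.1 hind
    (fun i => ∑ b with c b = i, y' b - ∑ b with c b = i, y b) ?_ i
  ext a j
  simp [sub_mul, sum_sub_distrib, key, h]

/-- Splitting a nonnegative combination along the fibres of `c`, normalizing each part. -/
theorem exists_mem_convexHull_sum_fiber_smul {B I E : Type*} [Fintype B] [Fintype I]
    [DecidableEq I] [AddCommGroup E] [Module ℝ E] {c : B → I} (hc : Function.Surjective c)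
    {y : B → ℝ} (hy : ∀ b, 0 ≤ y b) (v : B → E) :
    ∃ f : I → E, (∀ i, f i ∈ convexHull ℝ {x | ∃ b, c b = i ∧ x = v b}) ∧
      ∑ b, y b • v b = ∑ i, (∑ b with c b = i, y b) • f i := by
  have hcellwise (i : I) : ∃ x ∈ convexHull ℝ {x | ∃ b, c b = i ∧ x = v b},
      ∑ b with c b = i, y b • v b = (∑ b with c b = i, y b) • x := by
    rcases (sum_nonneg fun b _ => hy b : 0 ≤ ∑ b with c b = i, y b).eq_or_lt with h0 | hpos
    · obtain ⟨b, hb⟩ := hc i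
      refine ⟨v b, subset_convexHull ℝ _ ⟨b, hb, rfl⟩, ?_⟩
      rw [← h0, zero_smul]
      refine sum_eq_zero fun b hb => ?_
      rw [(sum_eq_zero_iff_of_nonneg fun b _ => hy b).1 h0.symm b hb, zero_smul]
    · refine ⟨centerMass {b | c b = i} y v, centerMass_mem_convexHull _ (fun b _ => hy b) hpos
        fun b hb => ⟨b, (mem_filter.1 hb).2, rfl⟩, ?_⟩
      rw [centerMass, smul_inv_smul₀ hpos.ne']
  choose f hf hsum using hcellwise
  refine ⟨f, hf, ?_⟩
  rw [← sum_fiberwise univ c]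
  exact sum_congr rfl fun i _ => hsum i

/-- with a semi-standard information structure for player 1 (cell map
`c : ℬ → ℐ`, signals `H̄ᵢ` constant on cells and linearly independent), setting
`𝒰ᵢ = conv{(u(a,b))ₐ : b ∈ ℬᵢ}`, the correspondence `Φ` is linear on `𝒴`:
`Φ(y) = Σ_i y_i 𝒰_i` (where `y_i` is the total mass of the cell `ℬᵢ`), and equivalently
`Φ(y) = Σ_b y[b] Φ(b)`, both as weighted Minkowski sums. -/
theorem semistandard_phi_linear
    {A B I : Type*} [Fintype A] [Fintype B] [Fintype I] [DecidableEq I] [DecidableEq B]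
    {d : ℕ} (u : A → B → ℝ) (H : A → B → Fin d → ℝ)
    (c : B → I) (hc : Function.Surjective c)
    (Hi : I → A → Fin d → ℝ)
    (hcell : ∀ b, (fun a => H a b) = Hi (c b))
    (hind : LinearIndependent ℝ Hi)
    (𝒰 : I → Set (A → ℝ))
    (h𝒰 : ∀ i, 𝒰 i = convexHull ℝ {U : A → ℝ | ∃ b, c b = i ∧ U = fun a => u a b})
    (y : B → ℝ) (hy : y ∈ stdSimplex ℝ B) :
    Phi u H y = {U : A → ℝ | ∃ f : I → (A → ℝ), (∀ i, f i ∈ 𝒰 i) ∧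
        U = ∑ i, (∑ b ∈ univ.filter (fun b => c b = i), y b) • f i} ∧
    Phi u H y = {U : A → ℝ | ∃ g : B → (A → ℝ),
        (∀ b, g b ∈ Phi u H (fun b' => if b' = b then (1 : ℝ) else 0)) ∧
        U = ∑ b, y b • g b} := by
  set S := {U : A → ℝ | ∃ f : I → (A → ℝ), (∀ i, f i ∈ 𝒰 i) ∧
    U = ∑ i, (∑ b ∈ univ.filter (fun b => c b = i), y b) • f i}
  set T := {U : A → ℝ | ∃ g : B → (A → ℝ),
    (∀ b, g b ∈ Phi u H (fun b' => if b' = b then (1 : ℝ) else 0)) ∧ U = ∑ b, y b • g b}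
  have hPhiS : Phi u H y ⊆ S := by
    rintro _ ⟨y', hy', hH, rfl⟩
    obtain ⟨f, hf, hsum⟩ := exists_mem_convexHull_sum_fiber_smul hc hy'.1 fun b a => u a b
    refine ⟨f, fun i => h𝒰 i ▸ hf i, ?_⟩
    simp only [← cell_mass_eq_of_signal_eq hcell hind hH, ← hsum]
    ext a
    simp
  have hST : S ⊆ T := by
    rintro _ ⟨f, hf, rfl⟩
    refine ⟨fun b => f (c b), fun b => ?_, ?_⟩
    · refine convexHull_min ?_ (convex_Phi u H _) (h𝒰 (c b) ▸ hf (c b))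
      rintro _ ⟨b', hb', rfl⟩
      refine payoff_mem_Phi_single u H (congrFun (?_ : (fun a => H a b') = fun a => H a b))
      rw [hcell, hcell, hb']
    · rw [← sum_fiberwise univ c]
      refine sum_congr rfl fun i _ => ?_
      rw [sum_smul]
      refine sum_congr rfl fun b hb => ?_
      dsimp only
      rw [(mem_filter.1 hb).2]
  have hTPhi : T ⊆ Phi u H y := by
    rintro _ ⟨g, hg, rfl⟩
    exact sum_smul_mem_Phi u H hy hg
  exact ⟨hPhiS.antisymm (hST.trans hTPhi), (hPhiS.trans hST).antisymm hTPhi⟩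
end

section
/- Assume player 1's information is semi-standard. Then there exists a finite subset {x_ℓ : ℓ ∈ 𝓛} of 𝒳 such that for every y ∈ 𝒴, the set M(y) = argmax_{x∈𝒳} min_{U∈Φ(y)} ⟨x,U⟩ contains at least one x_ℓ, and M(y) is contained in the convex hull of {x_ℓ : ℓ ∈ 𝓛 with x_ℓ ∈ M(y)} (in particular M(y) ⊆ conv{x_ℓ : ℓ ∈ 𝓛}). -/
/-- `inf1 S x = inf_{U ∈ S} ⟨x,U⟩`. -/
noncomputable def inf1 {n : Type*} [Fintype n] (S : Set (n → ℝ)) (x : n → ℝ) : ℝ :=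
  sInf ((fun U => ∑ i, x i * U i) '' S)

open Filter Topology in
/-- A polyhedron cut out by finitely many linear inequalities has finitely many extreme points. -/
theorem finite_extremePoints_polyhedron {E ι : Type*} [AddCommGroup E] [Module ℝ E] [Finite ι]
    (φ : ι → E →ₗ[ℝ] ℝ) (r : ι → ℝ) :
    ({x | ∀ j, φ j x ≤ r j}.extremePoints ℝ).Finite := by
  refine Set.Finite.of_finite_image (f := fun x => {j | φ j x = r j}) (Set.toFinite _) ?_
  intro x hx y hy hxy
  have hact : ∀ j, φ j x = r j → φ j y = r j := fun j hj => by
    have : j ∈ {j | φ j x = r j} := hj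
    rw [show {j | φ j x = r j} = {j | φ j y = r j} from hxy] at this
    exact this
  have hev : ∀ᶠ ε : ℝ in 𝓝[>] 0, ∀ j, φ j x + ε * (φ j x - φ j y) ≤ r j := by
    rw [eventually_all]
    intro j
    by_cases hj : φ j x = r j
    · exact Eventually.of_forall fun ε => by rw [hact j hj, hj]; simp
    · have hlt : φ j x < r j := lt_of_le_of_ne (hx.1 j) hj
      have hcont : Continuous fun ε : ℝ => φ j x + ε * (φ j x - φ j y) := by fun_prop
      have htend := hcont.tendsto 0
      simp only [zero_mul, add_zero] at htend
      exact ((htend.eventually (gt_mem_nhds hlt)).filter_mono nhdsWithin_le_nhds).mono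
        fun ε h => le_of_lt h
  obtain ⟨ε, hε, hpos⟩ := (hev.and self_mem_nhdsWithin).exists
  have hpos : 0 < ε := hpos
  have hz : x + ε • (x - y) ∈ {x | ∀ j, φ j x ≤ r j} := fun j => by simpa using hε j
  refine (hx.2 hy.1 hz ⟨ε / (1 + ε), 1 / (1 + ε), by positivity, by positivity, ?_, ?_⟩).symm
  · field_simp
    ring
  · match_scalars <;> field_simp
    ring

/-- A maximizer of a continuous linear functional over a compact convex set with finitely many
extreme points is a convex combination of extreme points which are also maximizers. -/
theorem mem_convexHull_extremePoints_of_isMaxOn {E : Type*} [AddCommGroup E] [Module ℝ E]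
    [TopologicalSpace E] [T2Space E] [IsTopologicalAddGroup E] [ContinuousSMul ℝ E]
    [LocallyConvexSpace ℝ E] {K : Set E} (hK : IsCompact K) (hconv : Convex ℝ K)
    (hfin : (K.extremePoints ℝ).Finite) (l : E →L[ℝ] ℝ) {x : E} (hx : x ∈ K)
    (hmax : IsMaxOn l K x) :
    x ∈ convexHull ℝ {e | e ∈ K.extremePoints ℝ ∧ l e = l x} := by
  have hexp : IsExposed ℝ K {z ∈ K | ∀ w ∈ K, l w ≤ l z} := fun _ => ⟨l, rfl⟩
  have hsub : {z ∈ K | ∀ w ∈ K, l w ≤ l z}.extremePoints ℝ ⊆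
      {e | e ∈ K.extremePoints ℝ ∧ l e = l x} := fun e he =>
    ⟨hexp.isExtreme.extremePoints_subset_extremePoints he,
      le_antisymm (hmax he.1.1) (he.1.2 x hx)⟩
  have hfin' := hfin.subset fun e (he : e ∈ {e | e ∈ K.extremePoints ℝ ∧ l e = l x}) => he.1
  have hKM := closure_convexHull_extremePoints (hexp.isCompact hK) (hexp.convex hconv)
  have hxF : x ∈ {z ∈ K | ∀ w ∈ K, l w ≤ l z} := ⟨hx, fun w hw => hmax hw⟩
  rw [← hKM] at hxF
  exact closure_minimal (convexHull_mono hsub) (hfin'.isClosed_convexHull ℝ) hxF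

/-- The mixed actions against which, in each information cell `i`, the pure action `s i` minimizes
the payoff. -/
def selectionCell {A B I : Type*} [Fintype A] (u : A → B → ℝ) (c : B → I) (s : I → B) :
    Set (A → ℝ) :=
  {x ∈ stdSimplex ℝ A | ∀ b, ∑ a, x a * u a (s (c b)) ≤ ∑ a, x a * u a b}

theorem convex_selectionCell {A B I : Type*} [Fintype A] (u : A → B → ℝ) (c : B → I)
    (s : I → B) : Convex ℝ (selectionCell u c s) := by
  intro x hx y hy p q hp hq hpq
  refine ⟨convex_stdSimplex ℝ A hx.1 hy.1 hp hq hpq, fun b => ?_⟩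
  have key : ∀ b', ∑ a, (p • x + q • y) a * u a b' =
      p * ∑ a, x a * u a b' + q * ∑ a, y a * u a b' := fun b' => by
    simp [add_mul, Finset.sum_add_distrib, Finset.mul_sum, mul_assoc]
  rw [key, key]
  exact add_le_add (mul_le_mul_of_nonneg_left (hx.2 b) hp)
    (mul_le_mul_of_nonneg_left (hy.2 b) hq)

theorem isCompact_selectionCell {A B I : Type*} [Fintype A] (u : A → B → ℝ) (c : B → I)
    (s : I → B) : IsCompact (selectionCell u c s) := by
  refine (isCompact_stdSimplex ℝ A).inter_right
    (t := {x | ∀ b, ∑ a, x a * u a (s (c b)) ≤ ∑ a, x a * u a b}) ?_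
  rw [Set.ofPred_forall]
  exact isClosed_iInter fun b => isClosed_le (by fun_prop) (by fun_prop)

theorem finite_extremePoints_selectionCell {A B I : Type*} [Fintype A] [Finite B]
    (u : A → B → ℝ) (c : B → I) (s : I → B) :
    ((selectionCell u c s).extremePoints ℝ).Finite := by
  let pay : B → (A → ℝ) →ₗ[ℝ] ℝ := fun b => ∑ a, u a b • LinearMap.proj a
  let tot : (A → ℝ) →ₗ[ℝ] ℝ := ∑ a, LinearMap.proj a
  let φ : (A ⊕ B) ⊕ (Unit ⊕ Unit) → (A → ℝ) →ₗ[ℝ] ℝ :=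
    Sum.elim (Sum.elim (fun a => -LinearMap.proj a) fun b => pay (s (c b)) - pay b)
      (Sum.elim (fun _ => tot) fun _ => -tot)
  let r : (A ⊕ B) ⊕ (Unit ⊕ Unit) → ℝ :=
    Sum.elim 0 (Sum.elim (fun _ => 1) fun _ => -1)
  have h : selectionCell u c s = {x | ∀ j, φ j x ≤ r j} := by
    ext x
    simp only [selectionCell, stdSimplex, Set.mem_ofPred_eq, Sum.forall, φ, r, pay, tot]
    simp [LinearMap.sum_apply, mul_comm, le_antisymm_iff]
    tauto
  rw [h]
  exact finite_extremePoints_polyhedron φ r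

/-- Under semi-standard information, indistinguishable mixed actions give the same mass to every
information cell, hence the same average to any function of the cell. -/
theorem sum_comp_eq_of_sum_signal_eq {A B I : Type*} [Fintype B] [Fintype I] {d : ℕ}
    {H : A → B → Fin d → ℝ} {c : B → I} {Hi : I → A → Fin d → ℝ}
    (hcell : ∀ b, (fun a => H a b) = Hi (c b)) (hind : LinearIndependent ℝ Hi)
    {y y' : B → ℝ} (h : ∀ a j, ∑ b, y' b * H a b j = ∑ b, y b * H a b j) (f : I → ℝ) :
    ∑ b, y' b * f (c b) = ∑ b, y b * f (c b) := by
  classical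
  have fiber : ∀ (g : I → ℝ) (w : B → ℝ),
      ∑ b, w b * g (c b) = ∑ i, (∑ b with c b = i, w b) * g i := fun g w => by
    rw [← Finset.sum_fiberwise Finset.univ c]
    refine Finset.sum_congr rfl fun i _ => ?_
    rw [Finset.sum_mul]
    refine Finset.sum_congr rfl fun b hb => ?_
    rw [(Finset.mem_filter.1 hb).2]
  have hH : ∀ a b j, H a b j = Hi (c b) a j := fun a b j => by rw [← hcell b]
  have hmass := Fintype.linearIndependent_iff.1 hind
    (fun i => (∑ b with c b = i, y' b) - ∑ b with c b = i, y b) (by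
      ext a j
      have := h a j
      simp only [hH] at this
      rw [fiber (fun i => Hi i a j), fiber (fun i => Hi i a j)] at this
      simp [sub_mul, Finset.sum_sub_distrib, this])
  rw [fiber, fiber]
  exact Finset.sum_congr rfl fun i _ => by rw [sub_eq_zero.1 (hmass i)]

/-- The worst payoff compatible with the information is linear on each selection cell. -/
theorem inf1_Phi_eq_of_mem_selectionCell {A B I : Type*} [Fintype A] [Fintype B] [Fintype I]
    {d : ℕ} {u : A → B → ℝ} {H : A → B → Fin d → ℝ} {c : B → I} {Hi : I → A → Fin d → ℝ}
    (hcell : ∀ b, (fun a => H a b) = Hi (c b)) (hind : LinearIndependent ℝ Hi)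
    {s : I → B} (hs : ∀ i, c (s i) = i) {y : B → ℝ} (hy : y ∈ stdSimplex ℝ B)
    {x : A → ℝ} (hx : x ∈ selectionCell u c s) :
    inf1 (Phi u H y) x = ∑ b, y b * ∑ a, x a * u a (s (c b)) := by
  classical
  have swap : ∀ w : B → ℝ, ∑ a, x a * ∑ b, w b * u a b = ∑ b, w b * ∑ a, x a * u a b :=
    fun w => by
      simp only [Finset.mul_sum]
      rw [Finset.sum_comm]
      exact Finset.sum_congr rfl fun b _ => Finset.sum_congr rfl fun a _ => by ring
  let w : B → ℝ := fun b' => ∑ b with s (c b) = b', y b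
  have hw : ∀ g : B → ℝ, ∑ b', w b' * g b' = ∑ b, y b * g (s (c b)) := fun g => by
    rw [← Finset.sum_fiberwise Finset.univ (fun b => s (c b)) fun b => y b * g (s (c b))]
    refine Finset.sum_congr rfl fun b' _ => ?_
    rw [Finset.sum_mul]
    refine Finset.sum_congr rfl fun b hb => ?_
    rw [(Finset.mem_filter.1 hb).2]
  refine IsLeast.csInf_eq ⟨⟨_, ⟨w, ⟨fun b => Finset.sum_nonneg fun b _ => hy.1 b, ?_⟩, ?_, rfl⟩,
    ?_⟩, ?_⟩
  · simpa [hy.2] using hw 1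
  · intro a j
    rw [hw fun b => H a b j]
    refine Finset.sum_congr rfl fun b _ => ?_
    have : H a (s (c b)) = H a b := by
      rw [congrFun (hcell (s (c b))) a, congrFun (hcell b) a, hs]
    rw [this]
  · exact (swap w).trans (hw _)
  · rintro _ ⟨_, ⟨y', hy', hsig, rfl⟩, rfl⟩
    change _ ≤ ∑ a, x a * ∑ b, y' b * u a b
    rw [swap, ← sum_comp_eq_of_sum_signal_eq hcell hind hsig fun i => ∑ a, x a * u a (s i)]
    exact Finset.sum_le_sum fun b _ => mul_le_mul_of_nonneg_left (hx.2 b) (hy'.1 b)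

theorem exists_mem_selectionCell {A B I : Type*} [Fintype A] [Finite B] (u : A → B → ℝ)
    {c : B → I} (hc : Function.Surjective c) {x : A → ℝ} (hx : x ∈ stdSimplex ℝ A) :
    ∃ s : I → B, (∀ i, c (s i) = i) ∧ x ∈ selectionCell u c s := by
  have hmin : ∀ i, ∃ b ∈ {b | c b = i}, ∀ b' ∈ {b | c b = i},
      ∑ a, x a * u a b ≤ ∑ a, x a * u a b' := fun i =>
    Set.exists_min_image _ _ (Set.toFinite _) (hc i)
  choose s hs hle using hmin
  exact ⟨s, hs, hx, fun b => hle (c b) b rfl⟩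

/-- under a semi-standard information structure for player 1, there exists a
finite subset `{x_ℓ}` of the simplex `𝒳` such that for every `y ∈ 𝒴`, the set
`M(y) = argmax_{x ∈ 𝒳} min_{U ∈ Φ(y)} ⟨x,U⟩` contains at least one `x_ℓ` and is contained
in the convex hull of those `x_ℓ` which belong to `M(y)`. -/
theorem semistandard_finite_best_replies
    {A B I : Type*} [Fintype A] [Fintype B] [Fintype I] {d : ℕ}
    (u : A → B → ℝ) (H : A → B → Fin d → ℝ)
    (c : B → I) (hc : Function.Surjective c)
    (Hi : I → A → Fin d → ℝ)
    (hcell : ∀ b, (fun a => H a b) = Hi (c b))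
    (hind : LinearIndependent ℝ Hi)
    (Mset : (B → ℝ) → Set (A → ℝ))
    (hM : ∀ y, Mset y = {x ∈ stdSimplex ℝ A |
      ∀ x' ∈ stdSimplex ℝ A, inf1 (Phi u H y) x' ≤ inf1 (Phi u H y) x}) :
    ∃ L : Finset (A → ℝ), (L : Set (A → ℝ)) ⊆ stdSimplex ℝ A ∧
      ∀ y ∈ stdSimplex ℝ B,
        (∃ x ∈ L, x ∈ Mset y) ∧
        Mset y ⊆ convexHull ℝ {x : A → ℝ | x ∈ L ∧ x ∈ Mset y} := by
  let S := {s : I → B // ∀ i, c (s i) = i}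
  have hfin : (⋃ s : S, (selectionCell u c s.1).extremePoints ℝ).Finite :=
    Set.finite_iUnion fun s => finite_extremePoints_selectionCell u c s.1
  have hLX : (⋃ s : S, (selectionCell u c s.1).extremePoints ℝ) ⊆ stdSimplex ℝ A :=
    Set.iUnion_subset fun s x hx => hx.1.1
  refine ⟨hfin.toFinset, by simpa using hLX, fun y hy => ?_⟩
  let l : S → (A → ℝ) →L[ℝ] ℝ := fun s =>
    ∑ b, y b • ∑ a, u a (s.1 (c b)) • ContinuousLinearMap.proj a
  have hl : ∀ s : S, ∀ x ∈ selectionCell u c s.1, inf1 (Phi u H y) x = l s x := fun s x hx => by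
    rw [inf1_Phi_eq_of_mem_selectionCell hcell hind s.2 hy hx]
    simp [l, mul_comm]
  have hhull : ∀ s : S, ∀ x ∈ selectionCell u c s.1, IsMaxOn (l s) (selectionCell u c s.1) x →
      x ∈ convexHull ℝ {e | e ∈ (selectionCell u c s.1).extremePoints ℝ ∧ l s e = l s x} :=
    fun s x hx hmax => mem_convexHull_extremePoints_of_isMaxOn (isCompact_selectionCell u c s.1)
      (convex_selectionCell u c s.1) (finite_extremePoints_selectionCell u c s.1) (l s) hx hmax
  constructor
  · have hdom : ∀ x ∈ stdSimplex ℝ A, ∃ e ∈ ⋃ s : S, (selectionCell u c s.1).extremePoints ℝ,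
        inf1 (Phi u H y) x ≤ inf1 (Phi u H y) e := by
      intro x hx
      obtain ⟨s, hs, hxs⟩ := exists_mem_selectionCell u hc hx
      obtain ⟨z, hz, hzmax⟩ := (isCompact_selectionCell u c s).exists_isMaxOn ⟨x, hxs⟩
        (l ⟨s, hs⟩).continuous.continuousOn
      obtain ⟨e, he, hez⟩ := convexHull_nonempty_iff.1 ⟨z, hhull ⟨s, hs⟩ z hz hzmax⟩
      refine ⟨e, Set.mem_iUnion.2 ⟨⟨s, hs⟩, he⟩, ?_⟩
      rw [hl ⟨s, hs⟩ x hxs, hl ⟨s, hs⟩ e he.1, hez]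
      exact hzmax hxs
    have hB : Nonempty B := by
      by_contra hB
      rw [not_nonempty_iff] at hB
      simpa using hy.2
    obtain ⟨b⟩ := hB
    have hA : Nonempty A := by
      by_contra hA
      rw [not_nonempty_iff] at hA
      exact hind.ne_zero (c b) (Subsingleton.elim _ _)
    obtain ⟨a⟩ := hA
    classical
    obtain ⟨e₀, he₀, -⟩ := hdom _ (single_mem_stdSimplex ℝ a)
    obtain ⟨e, he, hemax⟩ := Set.exists_max_image _ (inf1 (Phi u H y)) hfin ⟨e₀, he₀⟩
    refine ⟨e, hfin.mem_toFinset.2 he, ?_⟩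
    rw [hM]
    refine ⟨hLX he, fun x hx => ?_⟩
    obtain ⟨e', he', hle⟩ := hdom x hx
    exact hle.trans (hemax e' he')
  · intro x hx
    rw [hM] at hx
    obtain ⟨s, hs, hxs⟩ := exists_mem_selectionCell u hc hx.1
    have hmax : IsMaxOn (l ⟨s, hs⟩) (selectionCell u c s) x := fun z hz => by
      have := hx.2 z hz.1
      rwa [hl ⟨s, hs⟩ z hz, hl ⟨s, hs⟩ x hxs] at this
    refine convexHull_mono ?_ (hhull ⟨s, hs⟩ x hxs hmax)
    rintro e ⟨he, hex⟩
    refine ⟨hfin.mem_toFinset.2 (Set.mem_iUnion.2 ⟨⟨s, hs⟩, he⟩), ?_⟩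
    rw [hM]
    refine ⟨he.1.1, fun z hz => ?_⟩
    rw [hl ⟨s, hs⟩ e he.1, hex, ← hl ⟨s, hs⟩ x hxs]
    exact hx.2 z hz
end

section
/- Assume the game has a semi-standard structure for both players, and let finite families (x_ℓ)_{ℓ∈𝓛} in 𝒳 and (y_k)_{k∈𝓚} in 𝒴 be such that for every y ∈ 𝒴 the set argmax_{x∈𝒳} min_{U∈Φ(y)} ⟨x,U⟩ contains some x_ℓ and is contained in conv{x_ℓ : x_ℓ ∈ argmax_{x∈𝒳} min_{U∈Φ(y)} ⟨x,U⟩}, and dually for player 2 with (y_k) and Ψ. Define the auxiliary finite game Γ̃ with action sets 𝓛 and 𝓚 and payoffs ũ(ℓ,k) = min_{U∈Φ(y_k)} ⟨x_ℓ,U⟩ and ṽ(ℓ,k) = min_{V∈Ψ(x_ℓ)} ⟨y_k,V⟩, extended bilinearly to Δ(𝓛)×Δ(𝓚). If (𝐱,𝐲) ∈ Δ(𝓛)×Δ(𝓚) is a Nash equilibrium of Γ̃ (i.e. ũ(𝐱,𝐲) ≥ ũ(𝐱',𝐲) for all 𝐱' ∈ Δ(𝓛) and ṽ(𝐱,𝐲)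 ≥ ṽ(𝐱,𝐲') for all 𝐲' ∈ Δ(𝓚)), then the induced pair (x,y) = (Σ_ℓ 𝐱[ℓ] x_ℓ, Σ_k 𝐲[k] y_k) is a Nash equilibrium of the partial-monitoring game Γ. -/
/-- The uncertainty correspondence of player 2. -/
def Psi {A B : Type*} [Fintype A] [Fintype B] {e : ℕ} (v : A → B → ℝ)
    (M : A → B → Fin e → ℝ) (x : A → ℝ) : Set (B → ℝ) :=
  {V | ∃ x' ∈ stdSimplex ℝ A, (∀ b j, ∑ a, x' a * M a b j = ∑ a, x a * M a b j) ∧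
    V = fun b => ∑ a, x' a * v a b}

/-- Best replies of player 1: maximizers of `x ↦ inf_{U ∈ Φ(y)} ⟨x,U⟩` over `𝒳 = Δ(𝒜)`. -/
noncomputable def BR1 {A B : Type*} [Fintype A] [Fintype B] {d : ℕ} (u : A → B → ℝ)
    (H : A → B → Fin d → ℝ) (y : B → ℝ) : Set (A → ℝ) :=
  {x ∈ stdSimplex ℝ A | ∀ x' ∈ stdSimplex ℝ A, inf1 (Phi u H y) x' ≤ inf1 (Phi u H y) x}

/-- Best replies of player 2: maximizers of `y ↦ inf_{V ∈ Ψ(x)} ⟨y,V⟩` over `𝒴 = Δ(ℬ)`. -/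
noncomputable def BR2 {A B : Type*} [Fintype A] [Fintype B] {e : ℕ} (v : A → B → ℝ)
    (M : A → B → Fin e → ℝ) (x : A → ℝ) : Set (B → ℝ) :=
  {y ∈ stdSimplex ℝ B | ∀ y' ∈ stdSimplex ℝ B, inf1 (Psi v M x) y' ≤ inf1 (Psi v M x) y}

/-- The total weight of a mixed action against a function of cells is determined by its
maximal informative signal. -/
theorem sum_mul_comp_eq_of_signal_eq {A B I : Type*} [Fintype B] [Fintype I] {d : ℕ}
    {H : A → B → Fin d → ℝ} {c : B → I} {Hi : I → A → Fin d → ℝ}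
    (hcell : ∀ b, (fun a => H a b) = Hi (c b)) (hind : LinearIndependent ℝ Hi)
    {y y' : B → ℝ} (h : ∀ a j, ∑ b, y' b * H a b j = ∑ b, y b * H a b j) (m : I → ℝ) :
    ∑ b, y' b * m (c b) = ∑ b, y b * m (c b) := by
  classical
  have fib : ∀ (z : B → ℝ) (f : I → ℝ),
      ∑ b, z b * f (c b) = ∑ i, (∑ b with c b = i, z b) * f i := by
    intro z f
    rw [← Finset.sum_fiberwise Finset.univ c]
    refine Finset.sum_congr rfl fun i _ => ?_
    rw [Finset.sum_mul]
    refine Finset.sum_congr rfl fun b hb => ?_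
    rw [(Finset.mem_filter.mp hb).2]
  have hH : ∀ a b j, H a b j = Hi (c b) a j := fun a b j => by rw [← hcell b]
  have hw : ∀ i, (∑ b with c b = i, y' b) - (∑ b with c b = i, y b) = 0 := by
    refine Fintype.linearIndependent_iff.mp hind _ ?_
    ext a j
    have := h a j
    simp only [hH] at this
    rw [fib y' (fun i => Hi i a j), fib y (fun i => Hi i a j)] at this
    simp only [Finset.sum_apply, Pi.smul_apply, smul_eq_mul, Pi.zero_apply, sub_mul,
      Finset.sum_sub_distrib]
    linarith
  rw [fib, fib]
  exact Finset.sum_congr rfl fun i _ => by rw [sub_eq_zero.mp (hw i)]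

/-- Under a semi-standard structure, the worst-case payoff against `Φ(y)` is the average over the
cells of the worst payoff in each cell. -/
theorem inf1_Phi_eq_sum {A B I : Type*} [Fintype A] [Fintype B] [Fintype I] {d : ℕ}
    (u : A → B → ℝ) {H : A → B → Fin d → ℝ} {c : B → I} {Hi : I → A → Fin d → ℝ}
    (hcell : ∀ b, (fun a => H a b) = Hi (c b)) (hind : LinearIndependent ℝ Hi)
    {x : A → ℝ} {m : I → ℝ} (hm : ∀ b, m (c b) ≤ ∑ a, x a * u a b)
    (hatt : ∀ i, ∃ b, c b = i ∧ m i = ∑ a, x a * u a b)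
    {y : B → ℝ} (hy : y ∈ stdSimplex ℝ B) :
    inf1 (Phi u H y) x = ∑ b, y b * m (c b) := by
  classical
  have swap : ∀ z : B → ℝ,
      ∑ a, x a * ∑ b, z b * u a b = ∑ b, z b * ∑ a, x a * u a b := by
    intro z
    simp only [Finset.mul_sum]
    rw [Finset.sum_comm]
    exact Finset.sum_congr rfl fun b _ => Finset.sum_congr rfl fun a _ => by ring
  choose β hβc hβm using hatt
  refine IsLeast.csInf_eq ⟨?_, ?_⟩
  · have hsum : ∀ f : B → ℝ, ∑ b', (∑ b, y b • (Pi.single (β (c b)) 1 : B → ℝ)) b' * f b' =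
        ∑ b, y b * f (β (c b)) := by
      intro f
      simp only [Finset.sum_apply, Pi.smul_apply, smul_eq_mul, Finset.sum_mul]
      rw [Finset.sum_comm]
      refine Finset.sum_congr rfl fun b _ => ?_
      simp [Pi.single_apply]
    have hmem : (∑ b, y b • (Pi.single (β (c b)) 1 : B → ℝ)) ∈ stdSimplex ℝ B :=
      (convex_stdSimplex ℝ B).sum_mem (fun b _ => hy.1 b) hy.2
        fun b _ => single_mem_stdSimplex ℝ _
    refine ⟨_, ⟨_, hmem, fun a j => ?_, rfl⟩, ?_⟩
    · rw [hsum fun b => H a b j]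
      refine Finset.sum_congr rfl fun b _ => ?_
      have : (fun a => H a (β (c b))) = fun a => H a b := by
        rw [hcell, hcell, hβc]
      rw [congrFun (congrFun this a) j]
    · simp only
      rw [swap, hsum fun b => ∑ a, x a * u a b]
      exact Finset.sum_congr rfl fun b _ => by rw [hβm]
  · rintro _ ⟨_, ⟨y', hy', hsig, rfl⟩, rfl⟩
    simp only
    rw [swap, ← sum_mul_comp_eq_of_signal_eq hcell hind hsig m]
    exact Finset.sum_le_sum fun b _ => mul_le_mul_of_nonneg_left (hm b) (hy'.1 b)

/-- A mixture of a finite family meeting every best-reply set, optimal in the auxiliary game,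
induces a best reply of player 1. -/
theorem sum_smul_mem_BR1 {A B I L K : Type*} [Fintype A] [Fintype B] [Fintype I]
    [Fintype L] [Fintype K] {d : ℕ} (u : A → B → ℝ) (H : A → B → Fin d → ℝ)
    {c : B → I} (hc : Function.Surjective c) {Hi : I → A → Fin d → ℝ}
    (hcell : ∀ b, (fun a => H a b) = Hi (c b)) (hind : LinearIndependent ℝ Hi)
    {xs : L → (A → ℝ)} {ys : K → (B → ℝ)}
    (hxs : ∀ ℓ, xs ℓ ∈ stdSimplex ℝ A) (hys : ∀ k, ys k ∈ stdSimplex ℝ B)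
    (hfam : ∀ y ∈ stdSimplex ℝ B, ∃ ℓ, xs ℓ ∈ BR1 u H y)
    {X : L → ℝ} {Y : K → ℝ} (hX : X ∈ stdSimplex ℝ L) (hY : Y ∈ stdSimplex ℝ K)
    (hNE : ∀ X' ∈ stdSimplex ℝ L,
      ∑ ℓ, ∑ k, X' ℓ * Y k * inf1 (Phi u H (ys k)) (xs ℓ) ≤
        ∑ ℓ, ∑ k, X ℓ * Y k * inf1 (Phi u H (ys k)) (xs ℓ)) :
    (∑ ℓ, X ℓ • xs ℓ) ∈ BR1 u H (∑ k, Y k • ys k) := by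
  classical
  have hmin : ∀ (x : A → ℝ) (i : I), ∃ b, c b = i ∧
      ∀ b', c b' = i → ∑ a, x a * u a b ≤ ∑ a, x a * u a b' := by
    intro x i
    obtain ⟨b₀, hb₀⟩ := hc i
    obtain ⟨b, hb, hle⟩ := (Finset.univ.filter fun b => c b = i).exists_min_image
      (fun b => ∑ a, x a * u a b) ⟨b₀, by simpa using hb₀⟩
    exact ⟨b, by simpa using hb, fun b' hb' => hle b' (by simpa using hb')⟩
  choose β hβc hβ using hmin
  have G : ∀ x, ∀ y ∈ stdSimplex ℝ B, inf1 (Phi u H y) x =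
      ∑ b, y b * ∑ a, x a * u a (β x (c b)) := fun x y hy =>
    inf1_Phi_eq_sum u hcell hind (m := fun i => ∑ a, x a * u a (β x i))
      (fun b => hβ x _ b rfl) (fun i => ⟨β x i, hβc x i, rfl⟩) hy
  have hy : (∑ k, Y k • ys k) ∈ stdSimplex ℝ B :=
    (convex_stdSimplex ℝ B).sum_mem (fun k _ => hY.1 k) hY.2 fun k _ => hys k
  have hx : (∑ ℓ, X ℓ • xs ℓ) ∈ stdSimplex ℝ A :=
    (convex_stdSimplex ℝ A).sum_mem (fun ℓ _ => hX.1 ℓ) hX.2 fun ℓ _ => hxs ℓ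
  set y := ∑ k, Y k • ys k with hydef
  have hlin : ∀ x, inf1 (Phi u H y) x = ∑ k, Y k * inf1 (Phi u H (ys k)) x := by
    intro x
    simp only [G x y hy, fun k => G x (ys k) (hys k)]
    simp only [hydef, Finset.sum_apply, Pi.smul_apply, smul_eq_mul, Finset.sum_mul]
    rw [Finset.sum_comm]
    refine Finset.sum_congr rfl fun k _ => ?_
    rw [Finset.mul_sum]
    exact Finset.sum_congr rfl fun b _ => mul_assoc _ _ _
  have hpay : ∀ Z : L → ℝ, ∑ ℓ, ∑ k, Z ℓ * Y k * inf1 (Phi u H (ys k)) (xs ℓ) =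
      ∑ ℓ, Z ℓ * inf1 (Phi u H y) (xs ℓ) := by
    intro Z
    refine Finset.sum_congr rfl fun ℓ _ => ?_
    rw [hlin, Finset.mul_sum]
    exact Finset.sum_congr rfl fun k _ => mul_assoc _ _ _
  have hconc : ∑ ℓ, X ℓ * inf1 (Phi u H y) (xs ℓ) ≤
      inf1 (Phi u H y) (∑ ℓ, X ℓ • xs ℓ) := by
    rw [G _ y hy]
    generalize β (∑ ℓ, X ℓ • xs ℓ) = γ, hβc (∑ ℓ, X ℓ • xs ℓ) = hγ
    calc ∑ ℓ, X ℓ * inf1 (Phi u H y) (xs ℓ)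
        = ∑ ℓ, X ℓ * ∑ b, y b * ∑ a, xs ℓ a * u a (β (xs ℓ) (c b)) :=
          Finset.sum_congr rfl fun ℓ _ => by rw [G _ y hy]
      _ ≤ ∑ ℓ, X ℓ * ∑ b, y b * ∑ a, xs ℓ a * u a (γ (c b)) := by
          refine Finset.sum_le_sum fun ℓ _ => mul_le_mul_of_nonneg_left ?_ (hX.1 ℓ)
          exact Finset.sum_le_sum fun b _ =>
            mul_le_mul_of_nonneg_left (hβ _ _ _ (hγ _)) (hy.1 b)
      _ = ∑ b, y b * ∑ a, (∑ ℓ, X ℓ • xs ℓ) a * u a (γ (c b)) := by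
          simp only [Finset.sum_apply, Pi.smul_apply, smul_eq_mul, Finset.sum_mul,
            Finset.mul_sum]
          rw [Finset.sum_comm]
          refine Finset.sum_congr rfl fun b _ => ?_
          rw [Finset.sum_comm]
          exact Finset.sum_congr rfl fun a _ => Finset.sum_congr rfl fun ℓ _ => by ring
  obtain ⟨ℓ₀, -, hbest⟩ := hfam y hy
  have hdev := hNE _ (single_mem_stdSimplex ℝ ℓ₀)
  rw [hpay, hpay] at hdev
  simp only [Pi.single_apply, ite_mul, one_mul, zero_mul, Finset.sum_ite_eq',
    Finset.mem_univ, if_true] at hdev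
  exact ⟨hx, fun x' hx' => (hbest x' hx').trans (hdev.trans hconc)⟩

/-- under a semi-standard structure for both players, given finite families
`(x_ℓ)` and `(y_k)` such that for every opponent's mixed action the best-reply set contains
some member of the family and is contained in the convex hull of those members that are
best replies, every Nash equilibrium `(𝐱,𝐲)` of the auxiliary full-monitoring game `Γ̃`
(with payoffs `ũ(ℓ,k) = min_{U ∈ Φ(y_k)} ⟨x_ℓ,U⟩`, `ṽ(ℓ,k) = min_{V ∈ Ψ(x_ℓ)} ⟨y_k,V⟩`)
induces a Nash equilibrium `(Σ_ℓ 𝐱[ℓ]x_ℓ, Σ_k 𝐲[k]y_k)` of the partial-monitoring game. -/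
theorem auxiliary_nash_induces_nash
    {A B I J L K : Type*} [Fintype A] [Fintype B] [Fintype I] [Fintype J]
    [Fintype L] [Fintype K] {d e : ℕ}
    (u v : A → B → ℝ) (H : A → B → Fin d → ℝ) (M : A → B → Fin e → ℝ)
    -- semi-standard structure for player 1
    (c₁ : B → I) (hc₁ : Function.Surjective c₁)
    (Hi : I → A → Fin d → ℝ) (hcell₁ : ∀ b, (fun a => H a b) = Hi (c₁ b))
    (hind₁ : LinearIndependent ℝ Hi)
    -- semi-standard structure for player 2
    (c₂ : A → J) (hc₂ : Function.Surjective c₂)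
    (Mj : J → B → Fin e → ℝ) (hcell₂ : ∀ a, (fun b => M a b) = Mj (c₂ a))
    (hind₂ : LinearIndependent ℝ Mj)
    -- the finite families of required best replies
    (xs : L → (A → ℝ)) (ys : K → (B → ℝ))
    (hxs : ∀ ℓ, xs ℓ ∈ stdSimplex ℝ A) (hys : ∀ k, ys k ∈ stdSimplex ℝ B)
    (hfam₁ : ∀ y ∈ stdSimplex ℝ B, (∃ ℓ, xs ℓ ∈ BR1 u H y) ∧
      BR1 u H y ⊆ convexHull ℝ {x : A → ℝ | ∃ ℓ, x = xs ℓ ∧ xs ℓ ∈ BR1 u H y})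
    (hfam₂ : ∀ x ∈ stdSimplex ℝ A, (∃ k, ys k ∈ BR2 v M x) ∧
      BR2 v M x ⊆ convexHull ℝ {y : B → ℝ | ∃ k, y = ys k ∧ ys k ∈ BR2 v M x})
    -- the auxiliary game Γ̃
    (ut vt : L → K → ℝ)
    (hut : ∀ ℓ k, ut ℓ k = inf1 (Phi u H (ys k)) (xs ℓ))
    (hvt : ∀ ℓ k, vt ℓ k = inf1 (Psi v M (xs ℓ)) (ys k))
    -- a Nash equilibrium of Γ̃
    (X : L → ℝ) (Y : K → ℝ) (hX : X ∈ stdSimplex ℝ L) (hY : Y ∈ stdSimplex ℝ K)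
    (hNE₁ : ∀ X' ∈ stdSimplex ℝ L,
      ∑ ℓ, ∑ k, X' ℓ * Y k * ut ℓ k ≤ ∑ ℓ, ∑ k, X ℓ * Y k * ut ℓ k)
    (hNE₂ : ∀ Y' ∈ stdSimplex ℝ K,
      ∑ ℓ, ∑ k, X ℓ * Y' k * vt ℓ k ≤ ∑ ℓ, ∑ k, X ℓ * Y k * vt ℓ k) :
    (∑ ℓ, X ℓ • xs ℓ) ∈ BR1 u H (∑ k, Y k • ys k) ∧
    (∑ k, Y k • ys k) ∈ BR2 v M (∑ ℓ, X ℓ • xs ℓ) := by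
  simp only [hut] at hNE₁
  simp only [hvt] at hNE₂
  refine ⟨sum_smul_mem_BR1 u H hc₁ hcell₁ hind₁ hxs hys (fun y hy => (hfam₁ y hy).1) hX hY hNE₁,
    sum_smul_mem_BR1 (fun b a => v a b) (fun b a => M a b) hc₂ hcell₂ hind₂ hys hxs
      (fun x hx => (hfam₂ x hx).1) hY hX fun Y' hY' => ?_⟩
  have hcomm : ∀ Z : K → ℝ,
      ∑ k, ∑ ℓ, Z k * X ℓ * inf1 (Psi v M (xs ℓ)) (ys k) =
        ∑ ℓ, ∑ k, X ℓ * Z k * inf1 (Psi v M (xs ℓ)) (ys k) := by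
    intro Z
    rw [Finset.sum_comm]
    exact Finset.sum_congr rfl fun ℓ _ => Finset.sum_congr rfl fun k _ => by ring
  exact (hcomm Y').trans_le ((hNE₂ Y' hY').trans_eq (hcomm Y).symm)
end

section
/- Assume the game has a semi-standard structure for both players, and let finite families (x_ℓ)_{ℓ∈𝓛} in 𝒳 and (y_k)_{k∈𝓚} in 𝒴 be such that for every y ∈ 𝒴 the set argmax_{x∈𝒳} min_{U∈Φ(y)} ⟨x,U⟩ contains some x_ℓ and is contained in conv{x_ℓ : x_ℓ ∈ argmax_{x∈𝒳} min_{U∈Φ(y)} ⟨x,U⟩}, and dually for player 2 with (y_k) and Ψ. Define the auxiliary finite game Γ̃ with action sets 𝓛 and 𝓚 and payoffs ũ(ℓ,k) = min_{U∈Φ(y_k)} ⟨x_ℓ,U⟩ and ṽ(ℓ,k) = min_{V∈Ψ(x_ℓ)} ⟨y_k,V⟩, extended bilinearly to Δ(𝓛)×Δ(𝓚). Then every Nash equilibrium (x,y) of the partial-monitoring game Γ is induced by some Nash equilibrium of Γ̃: there exists (𝐱,𝐲) ∈ Δ(𝓛)×Δ(𝓚) with x = Σ_ℓ 𝐱[ℓ]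 x_ℓ and y = Σ_k 𝐲[k] y_k such that ũ(𝐱,𝐲) ≥ ũ(𝐱',𝐲) for all 𝐱' ∈ Δ(𝓛) and ṽ(𝐱,𝐲) ≥ ṽ(𝐱,𝐲') for all 𝐲' ∈ Δ(𝓚). -/
/-- Under a semi-standard structure the worst-case payoff of `x` is linear in the opponent's
mixed action. -/
lemma exists_inf1_Phi_eq_sum {A B I : Type*} [Fintype A] [Fintype B] [Fintype I] {d : ℕ}
    (u : A → B → ℝ) (H : A → B → Fin d → ℝ) (c : B → I) (hc : Function.Surjective c)
    (Hi : I → A → Fin d → ℝ) (hcell : ∀ b, (fun a => H a b) = Hi (c b))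
    (hind : LinearIndependent ℝ Hi) (x : A → ℝ) :
    ∃ m : B → ℝ, ∀ y ∈ stdSimplex ℝ B, inf1 (Phi u H y) x = ∑ b, y b * m b := by
  classical
  set g : B → ℝ := fun b => ∑ a, x a * u a b with hg
  have hmin : ∀ i, ∃ b, c b = i ∧ ∀ b', c b' = i → g b ≤ g b' := by
    intro i
    obtain ⟨b₀, hb₀⟩ := hc i
    obtain ⟨b, hb, hle⟩ := Finset.exists_min_image (Finset.univ.filter fun b => c b = i) g
      ⟨b₀, by simpa using hb₀⟩
    exact ⟨b, by simpa using hb, fun b' hb' => hle b' (by simpa using hb')⟩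
  choose β hβ hβmin using hmin
  have fiber : ∀ (w : B → ℝ) (f : I → ℝ),
      ∑ b, w b * f (c b) = ∑ i, (∑ b with c b = i, w b) * f i := by
    intro w f
    rw [← Finset.sum_fiberwise Finset.univ c]
    refine Finset.sum_congr rfl fun i _ => ?_
    rw [Finset.sum_mul]
    refine Finset.sum_congr rfl fun b hb => ?_
    rw [(Finset.mem_filter.1 hb).2]
  have hH : ∀ a b j, H a b j = Hi (c b) a j := fun a b j =>
    congrFun (congrFun (hcell b) a) j
  have payoff : ∀ w : B → ℝ, ∑ a, x a * ∑ b, w b * u a b = ∑ b, w b * g b := by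
    intro w
    simp only [hg, Finset.mul_sum]
    rw [Finset.sum_comm]
    exact Finset.sum_congr rfl fun _ _ => Finset.sum_congr rfl fun _ _ => by ring
  refine ⟨fun b => g (β (c b)), fun y hy => IsLeast.csInf_eq ⟨?_, ?_⟩⟩
  · -- the minimum is attained by moving the mass of each cell to a minimizer of that cell
    set w : B → ℝ := fun b' => ∑ b, if β (c b) = b' then y b else 0 with hw
    have push : ∀ f : B → ℝ, ∑ b', w b' * f b' = ∑ b, y b * f (β (c b)) := by
      intro f
      simp only [hw, Finset.sum_mul]
      rw [Finset.sum_comm]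
      simp [ite_mul]
    refine ⟨fun a => ∑ b, w b * u a b, ⟨w, ⟨fun b' => ?_, ?_⟩, fun a j => ?_, rfl⟩, ?_⟩
    · exact Finset.sum_nonneg fun b _ => by split_ifs <;> [exact hy.1 b; exact le_rfl]
    · have := push fun _ => 1
      simp only [mul_one] at this
      rw [this, hy.2]
    · rw [push fun b => H a b j]
      simp only [hH, hβ]
    · exact (payoff w).trans (push g)
  · rintro _ ⟨_, ⟨w, hw, hwH, rfl⟩, rfl⟩
    have hmass : ∀ i, ∑ b with c b = i, w b = ∑ b with c b = i, y b := by
      have := Fintype.linearIndependent_iff.1 hind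
        (fun i => ∑ b with c b = i, w b - ∑ b with c b = i, y b) (by
          ext a j
          have h := hwH a j
          simp only [hH] at h
          rw [fiber w fun i => Hi i a j, fiber y fun i => Hi i a j] at h
          simp only [Finset.sum_apply, Pi.smul_apply, smul_eq_mul, sub_mul,
            Finset.sum_sub_distrib, h, sub_self, Pi.zero_apply])
      exact fun i => sub_eq_zero.1 (this i)
    calc ∑ b, y b * g (β (c b)) = ∑ b, w b * g (β (c b)) := by
          rw [fiber y fun i => g (β i), fiber w fun i => g (β i)]
          simp only [hmass]
      _ ≤ ∑ b, w b * g b := Finset.sum_le_sum fun b _ =>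
          mul_le_mul_of_nonneg_left (hβmin _ _ rfl) (hw.1 b)
      _ = _ := (payoff w).symm

lemma exists_weights_of_mem_convexHull {L E : Type*} [Fintype L] [AddCommGroup E] [Module ℝ E]
    (p : L → E) (P : L → Prop) {x : E}
    (hx : x ∈ convexHull ℝ {z : E | ∃ l, z = p l ∧ P l}) :
    ∃ X ∈ stdSimplex ℝ L, (∀ l, X l ≠ 0 → P l) ∧ x = ∑ l, X l • p l := by
  classical
  refine convexHull_min (t := {x | ∃ X ∈ stdSimplex ℝ L, (∀ l, X l ≠ 0 → P l) ∧
    x = ∑ l, X l • p l}) ?_ ?_ hx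
  · rintro _ ⟨l, rfl, hl⟩
    refine ⟨Pi.single l 1, single_mem_stdSimplex ℝ l, fun l' h => ?_, ?_⟩
    · by_cases e : l' = l
      · exact e ▸ hl
      · simp [e] at h
    · simp [Pi.single_apply]
  · rintro _ ⟨X, hX, hXP, rfl⟩ _ ⟨Y, hY, hYP, rfl⟩ s t hs ht hst
    refine ⟨s • X + t • Y, convex_stdSimplex ℝ L hX hY hs ht hst, fun l hl => ?_, ?_⟩
    · by_cases h : X l = 0
      · exact hYP l fun h' => hl (by simp [h, h'])
      · exact hXP l h
    · simp [Finset.smul_sum, Finset.sum_add_distrib, add_smul, mul_smul]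

/-- Mixtures of best replies to `∑ k, Y k • ys k` maximize the payoff of the auxiliary game
against `Y`. -/
lemma sum_aux_payoff_le {A B I L K : Type*} [Fintype A] [Fintype B] [Fintype I] [Fintype L]
    [Fintype K] {d : ℕ}
    (u : A → B → ℝ) (H : A → B → Fin d → ℝ) (c : B → I) (hc : Function.Surjective c)
    (Hi : I → A → Fin d → ℝ) (hcell : ∀ b, (fun a => H a b) = Hi (c b))
    (hind : LinearIndependent ℝ Hi) (xs : L → A → ℝ) (ys : K → B → ℝ)
    (hxs : ∀ l, xs l ∈ stdSimplex ℝ A) (hys : ∀ k, ys k ∈ stdSimplex ℝ B)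
    {X X' : L → ℝ} {Y : K → ℝ} (hX : X ∈ stdSimplex ℝ L) (hX' : X' ∈ stdSimplex ℝ L)
    (hY : Y ∈ stdSimplex ℝ K) (hBR : ∀ l, X l ≠ 0 → xs l ∈ BR1 u H (∑ k, Y k • ys k)) :
    ∑ l, ∑ k, X' l * Y k * inf1 (Phi u H (ys k)) (xs l) ≤
      ∑ l, ∑ k, X l * Y k * inf1 (Phi u H (ys k)) (xs l) := by
  set y := ∑ k, Y k • ys k with hy
  have hymem : y ∈ stdSimplex ℝ B :=
    (convex_stdSimplex ℝ B).sum_mem (fun k _ => hY.1 k) hY.2 fun k _ => hys k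
  have collapse : ∀ Z : L → ℝ, ∑ l, ∑ k, Z l * Y k * inf1 (Phi u H (ys k)) (xs l) =
      ∑ l, Z l * inf1 (Phi u H y) (xs l) := by
    intro Z
    refine Finset.sum_congr rfl fun l _ => ?_
    obtain ⟨m, hm⟩ := exists_inf1_Phi_eq_sum u H c hc Hi hcell hind (xs l)
    simp only [mul_assoc, ← Finset.mul_sum]
    rw [hm y hymem]
    simp only [hm _ (hys _), hy, Finset.sum_apply, Pi.smul_apply, smul_eq_mul, Finset.sum_mul,
      Finset.mul_sum, mul_assoc]
    rw [Finset.sum_comm]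
  rw [collapse, collapse]
  obtain ⟨l₀, hl₀⟩ : ∃ l, X l ≠ 0 := by
    by_contra! h
    simpa [h] using hX.2
  have hmax : ∀ l, inf1 (Phi u H y) (xs l) ≤ inf1 (Phi u H y) (xs l₀) := fun l =>
    (hBR l₀ hl₀).2 _ (hxs l)
  calc ∑ l, X' l * inf1 (Phi u H y) (xs l)
      ≤ ∑ l, X' l * inf1 (Phi u H y) (xs l₀) := Finset.sum_le_sum fun l _ =>
        mul_le_mul_of_nonneg_left (hmax l) (hX'.1 l)
    _ = ∑ l, X l * inf1 (Phi u H y) (xs l₀) := by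
        rw [← Finset.sum_mul, ← Finset.sum_mul, hX.2, hX'.2]
    _ ≤ ∑ l, X l * inf1 (Phi u H y) (xs l) := Finset.sum_le_sum fun l _ => by
        by_cases h : X l = 0
        · simp [h]
        · exact mul_le_mul_of_nonneg_left ((hBR l h).2 _ (hxs l₀)) (hX.1 l)

/-- under a semi-standard structure for both players, with finite families
`(x_ℓ)`, `(y_k)` as in Lemma 1 and the auxiliary game `Γ̃` with payoffs
`ũ(ℓ,k) = min_{U ∈ Φ(y_k)} ⟨x_ℓ,U⟩` and `ṽ(ℓ,k) = min_{V ∈ Ψ(x_ℓ)} ⟨y_k,V⟩`, every Nash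
equilibrium `(x,y)` of the partial-monitoring game `Γ` is induced by some Nash equilibrium
`(𝐱,𝐲)` of `Γ̃`. -/
theorem nash_induced_by_auxiliary_nash
    {A B I J L K : Type*} [Fintype A] [Fintype B] [Fintype I] [Fintype J]
    [Fintype L] [Fintype K] {d e : ℕ}
    (u v : A → B → ℝ) (H : A → B → Fin d → ℝ) (M : A → B → Fin e → ℝ)
    -- semi-standard structure for player 1
    (c₁ : B → I) (hc₁ : Function.Surjective c₁)
    (Hi : I → A → Fin d → ℝ) (hcell₁ : ∀ b, (fun a => H a b) = Hi (c₁ b))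
    (hind₁ : LinearIndependent ℝ Hi)
    -- semi-standard structure for player 2
    (c₂ : A → J) (hc₂ : Function.Surjective c₂)
    (Mj : J → B → Fin e → ℝ) (hcell₂ : ∀ a, (fun b => M a b) = Mj (c₂ a))
    (hind₂ : LinearIndependent ℝ Mj)
    -- the finite families of required best replies
    (xs : L → (A → ℝ)) (ys : K → (B → ℝ))
    (hxs : ∀ ℓ, xs ℓ ∈ stdSimplex ℝ A) (hys : ∀ k, ys k ∈ stdSimplex ℝ B)
    (hfam₁ : ∀ y ∈ stdSimplex ℝ B, (∃ ℓ, xs ℓ ∈ BR1 u H y) ∧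
      BR1 u H y ⊆ convexHull ℝ {x : A → ℝ | ∃ ℓ, x = xs ℓ ∧ xs ℓ ∈ BR1 u H y})
    (hfam₂ : ∀ x ∈ stdSimplex ℝ A, (∃ k, ys k ∈ BR2 v M x) ∧
      BR2 v M x ⊆ convexHull ℝ {y : B → ℝ | ∃ k, y = ys k ∧ ys k ∈ BR2 v M x})
    -- the auxiliary game Γ̃
    (ut vt : L → K → ℝ)
    (hut : ∀ ℓ k, ut ℓ k = inf1 (Phi u H (ys k)) (xs ℓ))
    (hvt : ∀ ℓ k, vt ℓ k = inf1 (Psi v M (xs ℓ)) (ys k))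
    -- a Nash equilibrium of Γ
    (x : A → ℝ) (y : B → ℝ)
    (hNash₁ : x ∈ BR1 u H y) (hNash₂ : y ∈ BR2 v M x) :
    ∃ X ∈ stdSimplex ℝ L, ∃ Y ∈ stdSimplex ℝ K,
      x = ∑ ℓ, X ℓ • xs ℓ ∧ y = ∑ k, Y k • ys k ∧
      (∀ X' ∈ stdSimplex ℝ L,
        ∑ ℓ, ∑ k, X' ℓ * Y k * ut ℓ k ≤ ∑ ℓ, ∑ k, X ℓ * Y k * ut ℓ k) ∧
      (∀ Y' ∈ stdSimplex ℝ K,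
        ∑ ℓ, ∑ k, X ℓ * Y' k * vt ℓ k ≤ ∑ ℓ, ∑ k, X ℓ * Y k * vt ℓ k) := by
  obtain ⟨X, hX, hXBR, hx⟩ := exists_weights_of_mem_convexHull xs _ ((hfam₁ y hNash₂.1).2 hNash₁)
  obtain ⟨Y, hY, hYBR, hy⟩ := exists_weights_of_mem_convexHull ys _ ((hfam₂ x hNash₁.1).2 hNash₂)
  refine ⟨X, hX, Y, hY, hx, hy, fun X' hX' => ?_, fun Y' hY' => ?_⟩
  · simp only [hut]
    exact sum_aux_payoff_le u H c₁ hc₁ Hi hcell₁ hind₁ xs ys hxs hys hX hX' hY (hy ▸ hXBR)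
  · have key := sum_aux_payoff_le (fun b a => v a b) (fun b a => M a b) c₂ hc₂ Mj hcell₂ hind₂
      ys xs hys hxs hY hY' hX (hx ▸ hYBR)
    rw [Finset.sum_comm, Finset.sum_comm (f := fun l k => X l * Y k * vt l k)]
    simp only [hvt, mul_comm (X _)]
    exact key
end

section
/- Let T : ℝ^n → ℝ^m be a linear map and let P ⊆ ℝ^n be a polytope. Then the fiber correspondence μ ↦ T⁻¹(μ) ∩ P is piecewise linear on the polytope T(P): there exists a finite family of polytopes {Q_j : j ∈ 𝒥} whose union is T(P), whose pairwise intersections have empty interior relative to the affine hull of T(P), and such that for every j, every μ, μ' ∈ Q_j and every t ∈ [0,1], T⁻¹(tμ + (1−t)μ') ∩ P = t·(T⁻¹(μ) ∩ P) + (1−t)·(T⁻¹(μ') ∩ P) (weighted Minkowski sum). -/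
/-- `S` has empty interior relative to the affine hull of `P`. -/
def EmptyIntRel {n : Type*} [Fintype n] (P S : Set (n → ℝ)) : Prop :=
  interior ((↑) ⁻¹' S : Set (affineSpan ℝ P)) = ∅

theorem exists_finset_convexHull_eq_inter_halfSpace {E : Type*} [AddCommGroup E] [Module ℝ E]
    (G : Finset E) (h : E →ᵃ[ℝ] ℝ) :
    ∃ G' : Finset E, convexHull ℝ (G : Set E) ∩ {x | 0 ≤ h x} = convexHull ℝ (G' : Set E) := by
  classical
  set Gp := G.filter (fun x => 0 ≤ h x) with hGp
  set Gn := G.filter (fun x => ¬ 0 ≤ h x) with hGn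
  set p : E × E → E := fun q => AffineMap.lineMap q.1 q.2 (h q.1 / (h q.1 - h q.2)) with hp
  refine ⟨Gp ∪ (Gp ×ˢ Gn).image p, Set.Subset.antisymm ?_ ?_⟩
  · rintro x ⟨hx, hx0 : 0 ≤ h x⟩
    obtain ⟨w, hw0, hw1, rfl⟩ := Finset.mem_convexHull'.1 hx
    have hhx : h (∑ y ∈ G, w y • y) = ∑ y ∈ G, w y * h y := by
      have := Finset.map_affineCombination G id w hw1 h
      rw [Finset.affineCombination_eq_linear_combination _ _ _ hw1,
        Finset.affineCombination_eq_linear_combination _ _ _ hw1] at this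
      simpa using this
    rw [hhx, ← Finset.sum_filter_add_sum_filter_not G (fun x => 0 ≤ h x)] at hx0
    rw [← Finset.sum_filter_add_sum_filter_not G (fun x => 0 ≤ h x)] at hw1 ⊢
    rw [← hGp, ← hGn] at *
    have hwp : ∀ f ∈ Gp, 0 ≤ w f := fun f hf => hw0 f (Finset.mem_filter.1 hf).1
    have hwn : ∀ f ∈ Gn, 0 ≤ w f := fun f hf => hw0 f (Finset.mem_filter.1 hf).1
    have hhp : ∀ f ∈ Gp, 0 ≤ h f := fun f hf => (Finset.mem_filter.1 hf).2
    have hhn : ∀ f ∈ Gn, h f < 0 := fun f hf => not_le.1 (Finset.mem_filter.1 hf).2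
    set a := ∑ f ∈ Gp, w f * h f with ha
    set b := ∑ f ∈ Gn, w f * h f with hb
    have hb0 : b ≤ 0 := Finset.sum_nonpos fun f hf =>
      mul_nonpos_of_nonneg_of_nonpos (hwn f hf) (hhn f hf).le
    have hmemp : ∀ f ∈ Gp, f ∈ convexHull ℝ ((Gp ∪ (Gp ×ˢ Gn).image p : Finset E) : Set E) :=
      fun f hf => subset_convexHull ℝ _ (Finset.mem_coe.2 (Finset.mem_union_left _ hf))
    have hmemq : ∀ q ∈ Gp ×ˢ Gn,
        p q ∈ convexHull ℝ ((Gp ∪ (Gp ×ˢ Gn).image p : Finset E) : Set E) :=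
      fun q hq => subset_convexHull ℝ _
        (Finset.mem_coe.2 (Finset.mem_union_right _ (Finset.mem_image_of_mem p hq)))
    rcases eq_or_lt_of_le (show 0 ≤ a by linarith) with ha0 | ha0
    · have hb' : b = 0 := by linarith
      have hzero : ∀ f ∈ Gn, w f = 0 := by
        intro f hf
        have := (Finset.sum_eq_zero_iff_of_nonpos (fun f hf =>
          mul_nonpos_of_nonneg_of_nonpos (hwn f hf) (hhn f hf).le)).1 hb' f hf
        exact (mul_eq_zero.1 this).resolve_right (hhn f hf).ne
      rw [Finset.sum_eq_zero hzero, add_zero] at hw1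
      rw [Finset.sum_eq_zero (s := Gn) (fun f hf => by rw [hzero f hf, zero_smul]), add_zero]
      exact (convex_convexHull ℝ _).sum_mem hwp hw1 hmemp
    · let W : E ⊕ E × E → ℝ := Sum.elim (fun f => (1 + b / a) * w f)
        (fun q => w q.1 * w q.2 * (h q.1 - h q.2) / a)
      have key := (convex_convexHull ℝ
        ((Gp ∪ (Gp ×ˢ Gn).image p : Finset E) : Set E)).sum_mem
        (t := Gp.disjSum (Gp ×ˢ Gn)) (w := W) (z := Sum.elim id p) ?_ ?_ ?_
      · convert key using 1
        rw [Finset.sum_disjSum]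
        have hq : ∀ q ∈ Gp ×ˢ Gn, W (Sum.inr q) • Sum.elim id p (Sum.inr q) =
            (w q.2 * h q.2) • (-(w q.1 / a) • q.1) + (w q.1 * h q.1) • ((w q.2 / a) • q.2) := by
          intro q hq
          obtain ⟨h1, h2⟩ := Finset.mem_product.1 hq
          have hne : h q.1 - h q.2 ≠ 0 := by linarith [hhp _ h1, hhn _ h2]
          simp only [W, Sum.elim_inr, hp, AffineMap.lineMap_apply_module]
          match_scalars <;> field_simp
          ring
        rw [Finset.sum_congr rfl hq, Finset.sum_add_distrib, Finset.sum_product_right,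
          Finset.sum_product]
        dsimp only
        rw [← Finset.sum_smul_sum, ← Finset.sum_smul_sum, ← ha, ← hb,
          Finset.smul_sum, Finset.smul_sum, ← add_assoc, ← Finset.sum_add_distrib]
        congr 1
        · refine Finset.sum_congr rfl fun f _ => ?_
          simp only [W, Sum.elim_inl, id]
          match_scalars
          field_simp
          ring
        · refine Finset.sum_congr rfl fun f _ => ?_
          match_scalars
          field_simp
      · rintro (f | q) hi
        · have hf : f ∈ Gp := by simpa using hi
          have : 0 ≤ 1 + b / a := by
            rw [one_add_div ha0.ne']
            exact div_nonneg hx0 ha0.le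
          exact mul_nonneg this (hwp f hf)
        · obtain ⟨h1, h2⟩ := Finset.mem_product.1 (Finset.inr_mem_disjSum.1 hi)
          exact div_nonneg (mul_nonneg (mul_nonneg (hwp _ h1) (hwn _ h2))
            (by linarith [hhp _ h1, hhn _ h2])) ha0.le
      · rw [Finset.sum_disjSum]
        have hq : ∀ q ∈ Gp ×ˢ Gn, W (Sum.inr q) =
            (w q.2 * h q.2) * -(w q.1 / a) + (w q.1 * h q.1) * (w q.2 / a) := by
          intro q _
          simp only [W, Sum.elim_inr]
          ring
        rw [Finset.sum_congr rfl hq, Finset.sum_add_distrib, Finset.sum_product_right,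
          Finset.sum_product]
        dsimp only
        rw [← Finset.sum_mul_sum, ← Finset.sum_mul_sum, ← ha, ← hb,
          Finset.mul_sum, Finset.mul_sum, ← add_assoc, ← Finset.sum_add_distrib, ← hw1]
        congr 1
        · refine Finset.sum_congr rfl fun f _ => ?_
          simp only [W, Sum.elim_inl]
          ring
        · refine Finset.sum_congr rfl fun f _ => ?_
          field_simp
      · rintro (f | q) hi
        · exact hmemp f (by simpa using hi)
        · exact hmemq q (Finset.inr_mem_disjSum.1 hi)
  · apply convexHull_min
    · intro x hx
      rw [Finset.mem_coe, Finset.mem_union, Finset.mem_image] at hx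
      rcases hx with hx | ⟨q, hq, rfl⟩
      · exact ⟨subset_convexHull ℝ _ (Finset.mem_filter.1 hx).1, (Finset.mem_filter.1 hx).2⟩
      · obtain ⟨h1, h2⟩ := Finset.mem_product.1 hq
        obtain ⟨h1G, h1⟩ := Finset.mem_filter.1 h1
        obtain ⟨h2G, h2⟩ := Finset.mem_filter.1 h2
        have hpos : 0 < h q.1 - h q.2 := by linarith
        refine ⟨(convex_convexHull ℝ _).lineMap_mem (subset_convexHull ℝ _ h1G)
          (subset_convexHull ℝ _ h2G) ⟨div_nonneg h1 hpos.le, ?_⟩, ?_⟩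
        · rw [div_le_one hpos]
          linarith
        · simp only [hp, Set.mem_ofPred_eq, AffineMap.apply_lineMap, AffineMap.lineMap_apply_ring']
          refine le_of_eq ?_
          field_simp
          ring
    · exact (convex_convexHull ℝ _).inter ((convex_Ici (0:ℝ)).affine_preimage h)

theorem exists_finset_convexHull_eq_inter_halfSpaces {E κ : Type*} [AddCommGroup E] [Module ℝ E]
    (s : Finset κ) (G : Finset E) (h : κ → E →ᵃ[ℝ] ℝ) :
    ∃ G' : Finset E,
      convexHull ℝ (G : Set E) ∩ {x | ∀ k ∈ s, 0 ≤ h k x} = convexHull ℝ (G' : Set E) := by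
  classical
  induction s using Finset.induction_on with
  | empty => exact ⟨G, by simp⟩
  | insert k s _ ih =>
    obtain ⟨G₁, h₁⟩ := ih
    obtain ⟨G₂, h₂⟩ := exists_finset_convexHull_eq_inter_halfSpace G₁ (h k)
    refine ⟨G₂, ?_⟩
    rw [← h₂, ← h₁]
    ext x
    simp only [Finset.forall_mem_insert, Set.mem_inter_iff, Set.mem_ofPred_eq]
    tauto

theorem LinearMap.exists_generalized_inverse {K V W : Type*} [Field K] [AddCommGroup V]
    [Module K V] [AddCommGroup W] [Module K W] (A : V →ₗ[K] W) (U : Submodule K V)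
    (hU : Disjoint U (LinearMap.ker A)) :
    ∃ c : W →ₗ[K] V, (∀ v ∈ U, c (A v) = v) ∧ ∀ v, A (c (A v)) = A v := by
  obtain ⟨U', hUU', hc⟩ := hU.exists_isCompl
  have hinj : LinearMap.ker (A ∘ₗ U'.subtype) = ⊥ := by
    rw [LinearMap.ker_eq_bot']
    intro u hu
    exact Subtype.ext (Submodule.disjoint_def.1 hc.disjoint u u.2 hu)
  obtain ⟨g, hg⟩ := LinearMap.exists_leftInverse_of_injective _ hinj
  have hgU : ∀ v ∈ U', (g (A v) : V) = v := fun v hv =>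
    congrArg Subtype.val (LinearMap.congr_fun hg ⟨v, hv⟩)
  refine ⟨U'.subtype ∘ₗ g, fun v hv => hgU v (hUU' hv), fun v => ?_⟩
  obtain ⟨u, hu, k, hk, rfl⟩ := Submodule.mem_sup.1
    (hc.sup_eq_top ▸ Submodule.mem_top : v ∈ U' ⊔ LinearMap.ker A)
  rw [LinearMap.mem_ker] at hk
  simp [hk, hgU u hu]

/-- An extreme point of a fiber of a nonnegative orthant is determined by its vanishing
coordinates. -/
theorem disjoint_ker_of_mem_extremePoints {ι W : Type*} [Finite ι] [AddCommGroup W] [Module ℝ W]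
    (A : (ι → ℝ) →ₗ[ℝ] W) (e : W) {x : ι → ℝ}
    (hx : x ∈ Set.extremePoints ℝ {v : ι → ℝ | 0 ≤ v ∧ A v = e}) :
    Disjoint (Submodule.pi {i | x i = 0} fun _ => (⊥ : Submodule ℝ ℝ)) (LinearMap.ker A) := by
  rw [Submodule.disjoint_def]
  intro w hw hAw
  rw [LinearMap.mem_ker] at hAw
  obtain ⟨⟨hx0, hxA⟩, hext⟩ := hx
  have hsmall : ∀ u : ι → ℝ, (∀ i, x i = 0 → u i = 0) →
      ∀ᶠ s : ℝ in nhdsWithin 0 (Set.Ioi 0), 0 ≤ x + s • u := by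
    intro u hu
    refine nhdsWithin_le_nhds (Filter.eventually_all.2 fun i => ?_)
    rcases (hx0 i).eq_or_lt with hi | hi
    · have hi' : x i = 0 := hi.symm
      simp [hi', hu i hi']
    · have hcont : Continuous fun s : ℝ => (x + s • u) i := by
        simp only [Pi.add_apply, Pi.smul_apply, smul_eq_mul]
        fun_prop
      refine (hcont.continuousAt.eventually_const_lt ?_).mono fun s hs => hs.le
      simpa using hi
  have hw' : ∀ i, x i = 0 → w i = 0 := fun i hi => by simpa using hw i hi
  obtain ⟨s, ⟨h1, h2⟩, hs⟩ := (((hsmall w hw').and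
    (hsmall (-w) fun i hi => by simp [hw' i hi])).and self_mem_nhdsWithin).exists
  have := hext ⟨h1, by simp [hAw, hxA]⟩ ⟨h2, by simp [hAw, hxA]⟩
    ⟨1 / 2, 1 / 2, by norm_num, by norm_num, by norm_num, by module⟩
  exact (smul_eq_zero.1 (add_eq_left.1 this)).resolve_left (ne_of_gt hs)

/-- Finitely many linear functionals such that the fibers of a nonnegative orthant are linear
between points at which none of these functionals has opposite signs. -/
theorem exists_linearMap_fiber_subset {ι W : Type*} [Finite ι] [AddCommGroup W] [Module ℝ W]
    (A : (ι → ℝ) →ₗ[ℝ] W) :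
    ∃ c : Set ι → W →ₗ[ℝ] ι → ℝ, ∀ a b : ι → ℝ, ∀ t : ℝ, 0 < t → t < 1 →
      (∀ S i, 0 ≤ c S (A a) i ∧ 0 ≤ c S (A b) i ∨ c S (A a) i ≤ 0 ∧ c S (A b) i ≤ 0) →
      (∀ e, IsCompact {v : ι → ℝ | 0 ≤ v ∧ A v = e}) →
      ∀ v, 0 ≤ v → A v = t • A a + (1 - t) • A b →
        ∃ v₁ v₂, (0 ≤ v₁ ∧ A v₁ = A a) ∧ (0 ≤ v₂ ∧ A v₂ = A b) ∧ v = t • v₁ + (1 - t) • v₂ := by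
  have hex : ∀ S : Set ι, ∃ c : W →ₗ[ℝ] ι → ℝ,
      Disjoint (Submodule.pi S fun _ => (⊥ : Submodule ℝ ℝ)) (LinearMap.ker A) →
      (∀ v ∈ Submodule.pi S fun _ => (⊥ : Submodule ℝ ℝ), c (A v) = v) ∧
        ∀ v, A (c (A v)) = A v := by
    intro S
    by_cases h : Disjoint (Submodule.pi S fun _ => (⊥ : Submodule ℝ ℝ)) (LinearMap.ker A)
    · obtain ⟨c, hc⟩ := A.exists_generalized_inverse _ h
      exact ⟨c, fun _ => hc⟩
    · exact ⟨0, fun h' => absurd h' h⟩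
  choose c hc using hex
  refine ⟨c, fun a b t ht0 ht1 hsign hcomp v hv0 hv => ?_⟩
  set L : W → Set (ι → ℝ) := fun e => {v : ι → ℝ | 0 ≤ v ∧ A v = e} with hL
  have hconv : ∀ e, Convex ℝ (L e) := fun e =>
    (convex_Ici (𝕜 := ℝ) (0 : ι → ℝ)).inter ((convex_singleton (𝕜 := ℝ) e).linear_preimage A)
  set M : Set (ι → ℝ) := (fun p : (ι → ℝ) × (ι → ℝ) => t • p.1 + (1 - t) • p.2) ''
    (L (A a) ×ˢ L (A b)) with hM
  have hMcomp : IsCompact M := ((hcomp _).prod (hcomp _)).image (by fun_prop)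
  have hMconv : Convex ℝ M := ((hconv _).prod (hconv _)).linear_image
    (t • LinearMap.fst ℝ (ι → ℝ) (ι → ℝ) + (1 - t) • LinearMap.snd ℝ (ι → ℝ) (ι → ℝ))
  suffices h : L (t • A a + (1 - t) • A b) ⊆ M by
    obtain ⟨⟨v₁, v₂⟩, ⟨h₁, h₂⟩, rfl⟩ := h ⟨hv0, hv⟩
    exact ⟨v₁, v₂, h₁, h₂, rfl⟩
  rw [← closure_convexHull_extremePoints (show IsCompact (L _) from hcomp _) (hconv _)]
  refine closure_minimal (convexHull_min (fun x hx => ?_) hMconv) hMcomp.isClosed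
  obtain ⟨hc1, hc2⟩ := hc _ (disjoint_ker_of_mem_extremePoints A _ hx)
  obtain ⟨hx0, hxA⟩ := extremePoints_subset hx
  set S := {i | x i = 0}
  have hcx : x = t • c S (A a) + (1 - t) • c S (A b) := by
    have hfix := hc1 x fun i hi => hi
    rw [hxA, map_add, map_smul, map_smul] at hfix
    exact hfix.symm
  have hnonneg : ∀ i, 0 ≤ c S (A a) i ∧ 0 ≤ c S (A b) i := by
    intro i
    rcases hsign S i with h | ⟨h1, h2⟩
    · exact h
    · have hxi := hx0 i
      rw [hcx] at hxi
      simp only [Pi.zero_apply, Pi.add_apply, Pi.smul_apply, smul_eq_mul] at hxi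
      constructor <;> nlinarith
  exact ⟨(c S (A a), c S (A b)),
    ⟨⟨fun i => (hnonneg i).1, hc2 a⟩, ⟨fun i => (hnonneg i).2, hc2 b⟩⟩, hcx.symm⟩

theorem emptyIntRel_of_forall_eq_zero {n : Type*} [Fintype n] {P S : Set (n → ℝ)}
    (h : (n → ℝ) →ᵃ[ℝ] ℝ) (hS : ∀ x ∈ S, h x = 0) (hP : ∃ x ∈ P, h x ≠ 0) :
    EmptyIntRel P S := by
  rw [EmptyIntRel, Set.eq_empty_iff_forall_notMem]
  intro p hp
  obtain ⟨q, hq, hqh⟩ := hP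
  have hqA : q ∈ affineSpan ℝ P := subset_affineSpan ℝ P hq
  let γ : ℝ → affineSpan ℝ P := fun s =>
    ⟨AffineMap.lineMap p.1 q s, AffineMap.lineMap_mem s p.2 hqA⟩
  have hγ : Continuous γ := AffineMap.lineMap_continuous.subtype_mk _
  have hγ0 : γ 0 = p := Subtype.ext (by simp [γ])
  have hev : ∀ᶠ s in nhds (0 : ℝ), γ s ∈ interior ((↑) ⁻¹' S : Set (affineSpan ℝ P)) :=
    hγ.continuousAt.eventually (hγ0.symm ▸ isOpen_interior.mem_nhds hp)
  obtain ⟨s, hs, hs0⟩ := ((hev.filter_mono nhdsWithin_le_nhds).and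
    (self_mem_nhdsWithin (s := Set.Ioi 0))).exists
  have h1 : h (AffineMap.lineMap p.1 q s) = 0 := hS (γ s) (Set.mem_preimage.1 (interior_subset hs))
  have h2 : h p = 0 := hS _ (Set.mem_preimage.1 (interior_subset hp))
  rw [AffineMap.apply_lineMap, AffineMap.lineMap_apply_ring', h2] at h1
  simp only [sub_zero, add_zero] at h1
  exact (mul_eq_zero.1 h1).elim (ne_of_gt hs0) hqh

/-- for a linear map `T : ℝⁿ → ℝᵐ` and a polytope `P ⊆ ℝⁿ`, the fiber
correspondence `μ ↦ T⁻¹(μ) ∩ P` is piecewise linear on `T(P)`: there is a finite family of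
polytopes covering `T(P)`, with pairwise intersections of empty relative interior, on each of
which the correspondence is linear (fibers of convex combinations are the corresponding
weighted Minkowski sums of fibers). -/
theorem fiber_correspondence_piecewise_linear
    (n m : ℕ) (T : (Fin n → ℝ) →ₗ[ℝ] (Fin m → ℝ))
    (P : Set (Fin n → ℝ)) (hP : ∃ F : Finset (Fin n → ℝ), P = convexHull ℝ (F : Set (Fin n → ℝ))) :
    ∃ (N : ℕ) (Q : Fin N → Set (Fin m → ℝ)),
      (∀ j, ∃ G : Finset (Fin m → ℝ), Q j = convexHull ℝ (G : Set (Fin m → ℝ))) ∧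
      (⋃ j, Q j) = T '' P ∧
      (∀ j j', j ≠ j' → EmptyIntRel (T '' P) (Q j ∩ Q j')) ∧
      (∀ j, ∀ μ ∈ Q j, ∀ μ' ∈ Q j, ∀ t : ℝ, t ∈ Set.Icc (0 : ℝ) 1 →
        T ⁻¹' {t • μ + (1 - t) • μ'} ∩ P =
          {w : Fin n → ℝ | ∃ w₁ ∈ T ⁻¹' {μ} ∩ P, ∃ w₂ ∈ T ⁻¹' {μ'} ∩ P,
            w = t • w₁ + (1 - t) • w₂}) := by
  classical
  obtain ⟨F, rfl⟩ := hP
  obtain ⟨B, hFB⟩ : ∃ B : (F → ℝ) →ₗ[ℝ] (Fin n → ℝ),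
      convexHull ℝ (F : Set (Fin n → ℝ)) = B '' stdSimplex ℝ F := by
    refine ⟨Fintype.linearCombination ℝ Subtype.val, ?_⟩
    rw [← convexHull_basis_eq_stdSimplex, LinearMap.image_convexHull, ← Set.range_comp]
    congr 1
    ext x
    simp [Fintype.linearCombination_apply, ite_smul]
  have hTP : T '' convexHull ℝ (F : Set (Fin n → ℝ)) =
      convexHull ℝ ((F.image T : Finset (Fin m → ℝ)) : Set (Fin m → ℝ)) := by
    rw [T.image_convexHull, Finset.coe_image]
  set P := convexHull ℝ (F : Set (Fin n → ℝ)) with hP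
  obtain ⟨A, hA⟩ : ∃ A : (F → ℝ) →ₗ[ℝ] (Fin m → ℝ) × ℝ, ∀ v, A v = (T (B v), ∑ x, v x) :=
    ⟨(T ∘ₗ B).prod (∑ x : F, LinearMap.proj x), fun v => by simp⟩
  have hcomp : ∀ e, IsCompact {v : F → ℝ | 0 ≤ v ∧ A v = e} := by
    intro e
    refine (isCompact_Icc (a := (0 : F → ℝ)) (b := fun _ => e.2)).of_isClosed_subset
      ((isClosed_Ici (a := (0 : F → ℝ))).inter
        (isClosed_singleton.preimage A.continuous_of_finiteDimensional)) ?_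
    rintro v ⟨hv0, rfl⟩
    refine ⟨hv0, fun i => ?_⟩
    rw [hA]
    exact Finset.single_le_sum (fun j _ => hv0 j) (Finset.mem_univ i)
  have hlift : ∀ x ∈ P, ∀ y, T x = y → ∃ a : F → ℝ, 0 ≤ a ∧ A a = (y, 1) ∧ B a = x := by
    rintro x hx y rfl
    rw [hFB] at hx
    obtain ⟨a, ⟨ha0, ha1⟩, rfl⟩ := hx
    exact ⟨a, ha0, by rw [hA, ha1], rfl⟩
  have hproj : ∀ a : F → ℝ, ∀ y, 0 ≤ a → A a = (y, 1) → B a ∈ T ⁻¹' {y} ∩ P := by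
    intro a y ha0 ha
    rw [hA, Prod.mk.injEq] at ha
    exact ⟨ha.1, hFB ▸ ⟨a, ⟨ha0, ha.2⟩, rfl⟩⟩
  obtain ⟨c, hc⟩ := exists_linearMap_fiber_subset A
  obtain ⟨h, hh⟩ : ∃ h : Set F × F → (Fin m → ℝ) →ᵃ[ℝ] ℝ,
      ∀ k x, h k x = c k.1 (x, 1) k.2 :=
    ⟨fun k => (LinearMap.proj k.2 ∘ₗ c k.1).toAffineMap.comp
      ((AffineMap.id ℝ (Fin m → ℝ)).prod (AffineMap.const ℝ (Fin m → ℝ) (1 : ℝ))),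
      fun k x => rfl⟩
  let K := {k : Set F × F // ∃ x ∈ T '' P, ∃ y ∈ T '' P, h k x ≠ h k y}
  obtain ⟨g, hg⟩ : ∃ g : (K → Bool) → K → (Fin m → ℝ) →ᵃ[ℝ] ℝ,
      ∀ ε k x, g ε k x = if ε k then h k x else -h k x :=
    ⟨fun ε k => if ε k then h k else -h k, fun ε k x => by dsimp only; split_ifs <;> rfl⟩
  let Q : (K → Bool) → Set (Fin m → ℝ) := fun ε => T '' P ∩ {x | ∀ k ∈ Finset.univ, 0 ≤ g ε k x}
  let e := (Fintype.equivFin (K → Bool)).symm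
  refine ⟨Fintype.card (K → Bool), fun j => Q (e j), fun j => ?_, ?_, fun j j' hj => ?_,
    fun j μ hμ μ' hμ' t ht => ?_⟩
  · obtain ⟨G, hG⟩ := exists_finset_convexHull_eq_inter_halfSpaces Finset.univ (F.image T) (g (e j))
    exact ⟨G, by rw [← hG, ← hTP]⟩
  · refine (Set.iUnion_subset fun j => Set.inter_subset_left).antisymm fun x hx => ?_
    refine Set.mem_iUnion.2 ⟨e.symm fun k => decide (0 ≤ h k x), hx, fun k _ => ?_⟩
    rw [e.apply_symm_apply]
    by_cases hk : 0 ≤ h k x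
    · simp [hg, hk]
    · simp [hg, hk, (not_le.1 hk).le]
  · obtain ⟨k, hk⟩ := Function.ne_iff.1 (e.injective.ne hj)
    obtain ⟨x, hx, y, hy, hxy⟩ := k.2
    refine emptyIntRel_of_forall_eq_zero (h k) (fun z hz => ?_) ?_
    · have h1 := hz.1.2 k (Finset.mem_univ k)
      have h2 := hz.2.2 k (Finset.mem_univ k)
      rw [hg] at h1 h2
      cases hj1 : e j k <;> cases hj2 : e j' k <;>
        simp only [hj1, hj2, if_true, if_false, Bool.false_eq_true, ne_eq, not_true] at h1 h2 hk <;>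
        linarith
    · by_cases hx0 : h k x = 0
      · exact ⟨y, hy, fun hy0 => hxy (hx0.trans hy0.symm)⟩
      · exact ⟨x, hx, hx0⟩
  · obtain ⟨⟨p, hp, hpμ⟩, hμs⟩ := hμ
    obtain ⟨⟨p', hp', hpμ'⟩, hμs'⟩ := hμ'
    refine Set.Subset.antisymm ?_ ?_
    · rintro w ⟨hwT, hwP⟩
      have hwT' : T w = t • μ + (1 - t) • μ' := hwT
      rcases ht.1.eq_or_lt with rfl | ht0
      · exact ⟨p, ⟨hpμ, hp⟩, w, ⟨by simpa using hwT', hwP⟩, by simp⟩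
      rcases ht.2.eq_or_lt with rfl | ht1
      · exact ⟨w, ⟨by simpa using hwT', hwP⟩, p', ⟨hpμ', hp'⟩, by simp⟩
      obtain ⟨a, -, ha, -⟩ := hlift p hp μ hpμ
      obtain ⟨b, -, hb, -⟩ := hlift p' hp' μ' hpμ'
      obtain ⟨v, hv0, hv, rfl⟩ := hlift w hwP _ hwT'
      have hsign : ∀ S i, 0 ≤ c S (A a) i ∧ 0 ≤ c S (A b) i ∨
          c S (A a) i ≤ 0 ∧ c S (A b) i ≤ 0 := by
        intro S i
        rw [ha, hb, ← hh (S, i), ← hh (S, i)]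
        by_cases hk : ∃ x ∈ T '' P, ∃ y ∈ T '' P, h (S, i) x ≠ h (S, i) y
        · have h1 := hμs ⟨(S, i), hk⟩ (Finset.mem_univ _)
          have h2 := hμs' ⟨(S, i), hk⟩ (Finset.mem_univ _)
          cases hj : e j ⟨(S, i), hk⟩
          · exact Or.inr (by simpa [hg, hj] using And.intro h1 h2)
          · exact Or.inl (by simpa [hg, hj] using And.intro h1 h2)
        · push Not at hk
          rw [hk μ ⟨p, hp, hpμ⟩ μ' ⟨p', hp', hpμ'⟩, and_self, and_self]
          exact le_total _ _
      obtain ⟨v₁, v₂, ⟨h₁0, h₁⟩, ⟨h₂0, h₂⟩, rfl⟩ := hc a b t ht0 ht1 hsign hcomp v hv0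
        (by rw [hv, ha, hb]; ext <;> simp)
      exact ⟨B v₁, hproj v₁ μ h₁0 (h₁.trans ha), B v₂, hproj v₂ μ' h₂0 (h₂.trans hb), by simp⟩
    · rintro w ⟨w₁, ⟨h₁, h₁P⟩, w₂, ⟨h₂, h₂P⟩, rfl⟩
      have h₁' : T w₁ = μ := h₁
      have h₂' : T w₂ = μ' := h₂
      exact ⟨by simp [h₁', h₂'], convex_convexHull ℝ _ h₁P h₂P ht.1 (by linarith [ht.2]) (by ring)⟩
end

section
/- The uncertainty correspondence Φ is piecewise linear on 𝒴: there exists a finite family of polytopes {P_i : i ∈ ℐ} whose union is 𝒴, whose pairwise intersections have empty interior relative to the affine hull of 𝒴, and such that for every i, every y, y' ∈ P_i and every t ∈ [0,1], Φ(ty + (1−t)y') = t·Φ(y) + (1−t)·Φ(y') (weighted Minkowski sum). -/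
section Polyhedra

variable {E K : Type*} [AddCommGroup E] [Module ℝ E] [Finite K]

/-- Moving from a point of a polyhedron along a direction `v` that leaves it, and that is parallel
to the active constraints, one reaches a point with strictly more active constraints. -/
lemma exists_pos_more_active (g : K → E →ₗ[ℝ] ℝ) (c : K → ℝ) {x v : E}
    (hx : ∀ k, c k ≤ g k x) (hact : ∀ k, g k x = c k → g k v = 0) (hv : ∃ k, g k v < 0) :
    ∃ α : ℝ, 0 < α ∧ (∀ k, c k ≤ g k (x + α • v)) ∧
      {k | g k (x + α • v) ≠ c k} ⊂ {k | g k x ≠ c k} := by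
  have hfin : {k | g k v < 0}.Finite := Set.toFinite _
  obtain ⟨m, hm, hmin⟩ :=
    Set.exists_min_image {k | g k v < 0} (fun k => (g k x - c k) / (- g k v)) hfin hv
  have hm' : g m v < 0 := hm
  have hmx : c m < g m x := lt_of_le_of_ne (hx m) fun h => hm'.ne (hact m h.symm)
  have hα : 0 < (g m x - c m) / (- g m v) := div_pos (by linarith) (by linarith)
  refine ⟨(g m x - c m) / (- g m v), hα, fun k => ?_, ?_⟩
  · rw [map_add, map_smul, smul_eq_mul]
    rcases lt_or_ge (g k v) 0 with hk | hk
    · have h := hmin k hk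
      rw [le_div_iff₀ (by linarith)] at h
      linarith
    · have := mul_nonneg hα.le hk
      linarith [hx k]
  · rw [Set.ssubset_iff_of_subset]
    · refine ⟨m, hmx.ne', not_not.2 ?_⟩
      have hmne : g m v ≠ 0 := hm'.ne
      rw [map_add, map_smul, smul_eq_mul]
      field_simp
      ring
    · intro k hk hk'
      refine hk ?_
      rw [map_add, map_smul, hact k hk', hk', smul_zero, add_zero]

/-- A convex set that contains the basic points of a bounded polyhedron contains the polyhedron. -/
lemma mem_of_basic_mem (g : K → E →ₗ[ℝ] ℝ) (c : K → ℝ)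
    (hbdd : ∀ v, (∀ k, 0 ≤ g k v) → v = 0) {Q : Set E} (hQ : Convex ℝ Q)
    (hbasic : ∀ x, (∀ k, c k ≤ g k x) → (∀ v, (∀ k, g k x = c k → g k v = 0) → v = 0) → x ∈ Q)
    {x : E} (hx : ∀ k, c k ≤ g k x) : x ∈ Q := by
  induction hn : {k | g k x ≠ c k}.ncard using Nat.strong_induction_on generalizing x with
  | _ n ih =>
    subst hn
    by_cases hb : ∀ v, (∀ k, g k x = c k → g k v = 0) → v = 0
    · exact hbasic x hx hb
    push Not at hb
    obtain ⟨v, hact, hv⟩ := hb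
    have hneg : ∃ k, g k v < 0 := by
      by_contra! h
      exact hv (hbdd v h)
    have hpos : ∃ k, g k (-v) < 0 := by
      by_contra! h
      exact hv (neg_eq_zero.1 (hbdd (-v) h))
    obtain ⟨α, hα, hxα, hsα⟩ := exists_pos_more_active g c hx hact hneg
    obtain ⟨β, hβ, hxβ, hsβ⟩ := exists_pos_more_active g c hx
      (fun k hk => by rw [map_neg, hact k hk, neg_zero]) hpos
    have h₁ := ih _ (Set.ncard_lt_ncard hsα) hxα rfl
    have h₂ := ih _ (Set.ncard_lt_ncard hsβ) hxβ rfl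
    have hαβ : 0 < α + β := add_pos hα hβ
    have h := hQ h₁ h₂ (div_pos hβ hαβ).le (div_pos hα hαβ).le (by field_simp; ring)
    convert h using 1
    match_scalars <;> field_simp <;> ring

lemma finite_basic_points (g : K → E →ₗ[ℝ] ℝ) (c : K → ℝ) :
    {x : E | ∀ v, (∀ k, g k x = c k → g k v = 0) → v = 0}.Finite := by
  refine Set.Finite.of_finite_image (f := fun x => {k | g k x = c k}) (Set.toFinite _) ?_
  intro x hx y _ hxy
  refine sub_eq_zero.1 (hx (x - y) fun k hk => ?_)
  have hk' : g k y = c k := (Set.ext_iff.1 hxy k).1 hk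
  rw [map_sub, hk, hk', sub_self]

/-- A bounded polyhedron is a polytope. -/
lemma exists_finset_convexHull_eq (g : K → E →ₗ[ℝ] ℝ) (c : K → ℝ)
    (hbdd : ∀ v, (∀ k, 0 ≤ g k v) → v = 0) :
    ∃ F : Finset E, {x | ∀ k, c k ≤ g k x} = convexHull ℝ (F : Set E) := by
  have hfin : {x | (∀ k, c k ≤ g k x) ∧ ∀ v, (∀ k, g k x = c k → g k v = 0) → v = 0}.Finite :=
    (finite_basic_points g c).subset fun x hx => hx.2
  refine ⟨hfin.toFinset, ?_⟩
  rw [hfin.coe_toFinset]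
  apply Set.Subset.antisymm
  · intro x hx
    refine mem_of_basic_mem g c hbdd (convex_convexHull ℝ _) (fun y hy hb => ?_) hx
    exact subset_convexHull ℝ _ ⟨hy, hb⟩
  · refine convexHull_min (fun x hx => hx.1) ?_
    rw [Set.ofPred_forall]
    exact convex_iInter fun k => convex_halfSpace_ge (g k).isLinear (c k)

end Polyhedra

section Simplex

variable {B : Type*} [Fintype B]

/-- A subset of the simplex cut out by finitely many homogeneous inequalities is a polytope. -/
lemma exists_finset_convexHull_eq_stdSimplex_inter {K : Type*} [Finite K]
    (g : K → (B → ℝ) →ₗ[ℝ] ℝ) :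
    ∃ F : Finset (B → ℝ),
      {y | y ∈ stdSimplex ℝ B ∧ ∀ k, 0 ≤ g k y} = convexHull ℝ (F : Set (B → ℝ)) := by
  let s : (B → ℝ) →ₗ[ℝ] ℝ := ∑ b, LinearMap.proj b
  have hs : ∀ y, s y = ∑ b, y b := fun y => by simp [s]
  obtain ⟨F, hF⟩ := exists_finset_convexHull_eq
    (Sum.elim (Sum.elim (fun b => LinearMap.proj b) g) (fun i : Bool => bif i then s else -s))
    (Sum.elim (fun _ => 0) (fun i : Bool => bif i then 1 else -1)) (by
      intro v hv
      have h₀ : ∀ b, 0 ≤ v b := fun b => hv (.inl (.inl b))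
      have h₁ : 0 ≤ -s v := hv (.inr false)
      rw [hs] at h₁
      have h₂ : ∑ b, v b = 0 := le_antisymm (by linarith) (Finset.sum_nonneg fun b _ => h₀ b)
      funext b
      exact (Finset.sum_eq_zero_iff_of_nonneg fun b _ => h₀ b).1 h₂ b (Finset.mem_univ b))
  refine ⟨F, hF ▸ Set.ext fun y => ?_⟩
  simp only [Set.mem_ofPred_eq, Sum.forall, Sum.elim_inl, Sum.elim_inr, Bool.forall_bool,
    cond_true, cond_false, LinearMap.neg_apply, hs, LinearMap.proj_apply, stdSimplex]
  constructor
  · rintro ⟨⟨h₀, h₁⟩, h₂⟩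
    exact ⟨⟨h₀, h₂⟩, by rw [h₁], h₁.ge⟩
  · rintro ⟨⟨h₀, h₂⟩, h₃, h₄⟩
    exact ⟨⟨h₀, le_antisymm (by linarith) h₄⟩, h₂⟩

/-- A nonzero linear functional does not vanish on a relatively open part of the simplex. -/
lemma emptyIntRel_stdSimplex {g : (B → ℝ) →ₗ[ℝ] ℝ} (hg : g ≠ 0) {S : Set (B → ℝ)}
    (hS : ∀ y ∈ S, g y = 0) : EmptyIntRel (stdSimplex ℝ B) S := by
  classical
  rw [EmptyIntRel, Set.eq_empty_iff_forall_notMem]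
  intro p hp
  refine hg (LinearMap.pi_ext' fun b => LinearMap.ext_ring ?_)
  let q : B → ℝ := Pi.single b 1
  have hq : q ∈ affineSpan ℝ (stdSimplex ℝ B) :=
    subset_affineSpan ℝ _ (single_mem_stdSimplex ℝ b)
  let f : ℝ → affineSpan ℝ (stdSimplex ℝ B) := fun ε =>
    ⟨AffineMap.lineMap (p : B → ℝ) q ε, AffineMap.lineMap_mem ε p.2 hq⟩
  have hf : Continuous f := AffineMap.lineMap_continuous.subtype_mk _
  have hf₀ : f 0 = p := Subtype.ext (AffineMap.lineMap_apply_zero _ _)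
  have hnhds : ∀ᶠ ε in nhds (0 : ℝ), (f ε : B → ℝ) ∈ S :=
    hf.continuousAt (hf₀.symm ▸ mem_interior_iff_mem_nhds.1 hp)
  obtain ⟨δ, hδ, hball⟩ := Metric.eventually_nhds_iff.1 hnhds
  have h₀ : g p = 0 := hS _ (hf₀ ▸ hnhds.self_of_nhds)
  have h₁ : g (f (δ / 2)) = 0 := hS _ (hball (by
    rw [Real.dist_eq, sub_zero, abs_of_pos (by linarith)]; linarith))
  simp only [f, AffineMap.lineMap_apply_module, map_add, map_smul, h₀, smul_eq_mul, mul_zero,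
    zero_add, mul_eq_zero] at h₁
  simpa [q] using h₁.resolve_left (by linarith)

end Simplex

/-- There are finitely many linear functionals such that the fibres of a linear map in the
nonnegative orthant are affine along segments on which no functional changes sign. -/
lemma exists_functionals_fibre_decomposition {B ι : Type*} [Finite B] [Finite ι]
    (L : (B → ℝ) →ₗ[ℝ] (ι → ℝ)) (hL : ∀ v, 0 ≤ v → L v = 0 → v = 0) :
    ∃ g : Set B × (B ⊕ ι) → (B → ℝ) →ₗ[ℝ] ℝ,
      ∀ y y' : B → ℝ, (∀ k, (0 ≤ g k y ∧ 0 ≤ g k y') ∨ (g k y ≤ 0 ∧ g k y' ≤ 0)) →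
      ∀ t : ℝ, 0 < t → t < 1 → ∀ x, 0 ≤ x → L x = L (t • y + (1 - t) • y') →
        ∃ w w', (0 ≤ w ∧ L w = L y) ∧ (0 ≤ w' ∧ L w' = L y') ∧ x = t • w + (1 - t) • w' := by
  have hG : ∀ S : Set B, ∃ G : (ι → ℝ) →ₗ[ℝ] (B → ℝ),
      (∀ v : B → ℝ, (∀ b ∉ S, v b = 0) → L v = 0 → v = 0) →
      ∀ x : B → ℝ, (∀ b ∉ S, x b = 0) → G (L x) = x := by
    intro S
    by_cases h : ∀ v : B → ℝ, (∀ b ∉ S, v b = 0) → L v = 0 → v = 0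
    · let V : Submodule ℝ (B → ℝ) := Submodule.pi Sᶜ fun _ => ⊥
      have hV : ∀ v, v ∈ V ↔ ∀ b ∉ S, v b = 0 := fun v => by simp [V, Submodule.mem_pi]
      obtain ⟨G, hG⟩ := (L.domRestrict V).exists_leftInverse_of_injective (by
        refine LinearMap.ker_eq_bot'.2 fun v hv => Subtype.ext ?_
        exact h v ((hV v).1 v.2) hv)
      refine ⟨V.subtype ∘ₗ G, fun _ x hx => ?_⟩
      exact congrArg Subtype.val (LinearMap.congr_fun hG ⟨x, (hV x).2 hx⟩)
    · exact ⟨0, fun h' => absurd h' h⟩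
  choose G hG using hG
  refine ⟨fun k => k.2.elim (fun b => LinearMap.proj b ∘ₗ G k.1 ∘ₗ L)
    (fun i => LinearMap.proj i ∘ₗ (L ∘ₗ G k.1 ∘ₗ L - L)), ?_⟩
  intro y y' hyy t ht₀ ht₁ x hx hxL
  have hs : 0 < 1 - t := by linarith
  have hsign : ∀ p q : ℝ, (0 ≤ p ∧ 0 ≤ q) ∨ (p ≤ 0 ∧ q ≤ 0) → 0 ≤ t * p + (1 - t) * q →
      0 ≤ p ∧ 0 ≤ q := by
    rintro p q (h | ⟨hp, hq⟩) h
    · assumption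
    · constructor <;> nlinarith
  have hzero : ∀ p q : ℝ, (0 ≤ p ∧ 0 ≤ q) ∨ (p ≤ 0 ∧ q ≤ 0) → t * p + (1 - t) * q = 0 →
      p = 0 ∧ q = 0 := by
    intro p q h h₀
    have h₁ := hsign p q h h₀.ge
    have h₂ := hsign (-p) (-q) (by rcases h with h | h <;> simp [h]) (by linarith)
    constructor <;> linarith [h₁.1, h₁.2, h₂.1, h₂.2]
  let Q : Set (B → ℝ) := {x | ∃ w w', (0 ≤ w ∧ L w = L y) ∧ (0 ≤ w' ∧ L w' = L y') ∧
    x = t • w + (1 - t) • w'}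
  have hQ : Convex ℝ Q := by
    rintro _ ⟨w₁, w₁', ⟨h₁, e₁⟩, ⟨h₁', e₁'⟩, rfl⟩ _ ⟨w₂, w₂', ⟨h₂, e₂⟩, ⟨h₂', e₂'⟩, rfl⟩ a b ha hb hab
    refine ⟨a • w₁ + b • w₂, a • w₁' + b • w₂',
      ⟨add_nonneg (smul_nonneg ha h₁) (smul_nonneg hb h₂), ?_⟩,
      ⟨add_nonneg (smul_nonneg ha h₁') (smul_nonneg hb h₂'), ?_⟩, by module⟩
    · rw [map_add, map_smul, map_smul, e₁, e₂, ← add_smul, hab, one_smul]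
    · rw [map_add, map_smul, map_smul, e₁', e₂', ← add_smul, hab, one_smul]
  let z := t • y + (1 - t) • y'
  let f : B ⊕ ι ⊕ ι → (B → ℝ) →ₗ[ℝ] ℝ := Sum.elim (fun b => LinearMap.proj b)
    (Sum.elim (fun i => LinearMap.proj i ∘ₗ L) (fun i => -(LinearMap.proj i ∘ₗ L)))
  let c : B ⊕ ι ⊕ ι → ℝ := Sum.elim (fun _ => 0) (Sum.elim (fun i => L z i) (fun i => -L z i))
  refine mem_of_basic_mem f c (Q := Q) ?_ hQ ?_ (x := x) ?_
  · intro v hv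
    refine hL v (fun b => hv (.inl b)) (funext fun i => le_antisymm ?_ (hv (.inr (.inl i))))
    exact neg_nonneg.1 (hv (.inr (.inr i)))
  · intro x hx hbasic
    have hx₀ : 0 ≤ x := fun b => hx (.inl b)
    have hxL : L x = L z := funext fun i =>
      le_antisymm (neg_le_neg_iff.1 (hx (.inr (.inr i)))) (hx (.inr (.inl i)))
    let S : Set B := {b | x b ≠ 0}
    have hGx : G S (L z) = x := by
      rw [← hxL]
      refine hG S (fun v hv hLv => hbasic v ?_) x fun b hb => not_not.1 hb
      rintro (b | i | i) hk
      · exact hv b fun h => h hk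
      · exact congrFun hLv i
      · exact neg_eq_zero.2 (congrFun hLv i)
    have hcomb : t • G S (L y) + (1 - t) • G S (L y') = x := by
      rw [← hGx]
      simp only [z, map_add, map_smul]
    have hpos : ∀ b, 0 ≤ G S (L y) b ∧ 0 ≤ G S (L y') b := fun b =>
      hsign _ _ (hyy (S, .inl b)) ((hx₀ b).trans_eq (congrFun hcomb b).symm)
    have heq : ∀ i, (L (G S (L y)) - L y) i = 0 ∧ (L (G S (L y')) - L y') i = 0 := fun i => by
      refine hzero _ _ (hyy (S, .inr i)) ?_
      have h := congrFun (congrArg L hcomb) i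
      rw [hxL] at h
      simp only [z, map_add, map_smul, Pi.add_apply, Pi.smul_apply, smul_eq_mul] at h
      simp only [Pi.sub_apply]
      linarith
    exact ⟨_, _, ⟨fun b => (hpos b).1, sub_eq_zero.1 (funext fun i => (heq i).1)⟩,
      ⟨fun b => (hpos b).2, sub_eq_zero.1 (funext fun i => (heq i).2)⟩, hcomb.symm⟩
  · rintro (b | i | i)
    · exact hx b
    · exact (congrFun hxL i).ge
    · exact neg_le_neg (congrFun hxL i).le

/-- Points of a simplex with the same signals are the nonnegative points of a fibre of a linear
map. -/
lemma exists_linearMap_fibre_iff {A B : Type*} [Fintype A] [Fintype B] {d : ℕ}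
    (H : A → B → Fin d → ℝ) :
    ∃ L : (B → ℝ) →ₗ[ℝ] (Option (A × Fin d) → ℝ), (∀ v, 0 ≤ v → L v = 0 → v = 0) ∧
      ∀ y ∈ stdSimplex ℝ B, ∀ x, 0 ≤ x ∧ L x = L y ↔
        x ∈ stdSimplex ℝ B ∧ ∀ a j, ∑ b, x b * H a b j = ∑ b, y b * H a b j := by
  let M : Matrix B (Option (A × Fin d)) ℝ := fun b i => i.elim 1 fun p => H p.1 b p.2
  have h₀ : ∀ x, M.vecMulLinear x none = ∑ b, x b := fun x => by
    change ∑ b, x b * M b none = _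
    simp [M]
  have h₁ : ∀ x a j, M.vecMulLinear x (some (a, j)) = ∑ b, x b * H a b j := fun x a j => rfl
  refine ⟨M.vecMulLinear, fun v hv hLv => ?_, fun y hy x => ?_⟩
  · have h := congrFun hLv none
    rw [h₀] at h
    funext b
    exact (Finset.sum_eq_zero_iff_of_nonneg fun b _ => hv b).1 h b (Finset.mem_univ b)
  · rw [funext_iff, Option.forall, h₀, h₀, hy.2]
    simp only [Prod.forall, h₁]
    exact and_assoc.symm

/-- the uncertainty correspondence `Φ` is piecewise linear on `𝒴 = Δ(ℬ)`:
there is a finite family of polytopes covering `𝒴`, with pairwise intersections of empty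
interior relative to the affine hull of `𝒴`, on each of which `Φ` of a convex combination is
the corresponding weighted Minkowski sum. -/
theorem phi_piecewise_linear
    {A B : Type*} [Fintype A] [Fintype B] {d : ℕ}
    (u : A → B → ℝ) (H : A → B → Fin d → ℝ) :
    ∃ (N : ℕ) (P : Fin N → Set (B → ℝ)),
      (∀ i, ∃ F : Finset (B → ℝ), P i = convexHull ℝ (F : Set (B → ℝ))) ∧
      (⋃ i, P i) = stdSimplex ℝ B ∧
      (∀ i i', i ≠ i' → EmptyIntRel (stdSimplex ℝ B) (P i ∩ P i')) ∧
      (∀ i, ∀ y ∈ P i, ∀ y' ∈ P i, ∀ t : ℝ, t ∈ Set.Icc (0 : ℝ) 1 →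
        Phi u H (t • y + (1 - t) • y') =
          {W : A → ℝ | ∃ U ∈ Phi u H y, ∃ U' ∈ Phi u H y', W = t • U + (1 - t) • U'}) := by
  classical
  obtain ⟨L, hL, hfib⟩ := exists_linearMap_fibre_iff H
  obtain ⟨g, hg⟩ := exists_functionals_fibre_decomposition L hL
  let K := {k // g k ≠ 0}
  let sg : Set K → K → (B → ℝ) →ₗ[ℝ] ℝ := fun s k => if k ∈ s then g k else -g k
  let R : Set K → Set (B → ℝ) := fun s => {y | y ∈ stdSimplex ℝ B ∧ ∀ k, 0 ≤ sg s k y}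
  obtain ⟨N, ⟨e⟩⟩ := Finite.exists_equiv_fin (Set K)
  refine ⟨N, fun i => R (e.symm i), fun i => ?_, ?_, fun i i' hii => ?_, ?_⟩
  · exact exists_finset_convexHull_eq_stdSimplex_inter _
  · refine Set.Subset.antisymm (Set.iUnion_subset fun i y hy => hy.1) fun y hy => ?_
    refine Set.mem_iUnion.2 ⟨e {k | 0 ≤ g k y}, hy, fun k => ?_⟩
    rw [Equiv.symm_apply_apply]
    by_cases hk : 0 ≤ g k y
    · simp [sg, hk]
    · simpa [sg, hk] using (not_le.1 hk).le
  · obtain ⟨k, hk⟩ : ∃ k, ¬(k ∈ e.symm i ↔ k ∈ e.symm i') := by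
      by_contra! h
      exact hii (e.symm.injective (Set.ext h))
    refine emptyIntRel_stdSimplex k.2 fun y hy => ?_
    have h₁ := hy.1.2 k
    have h₂ := hy.2.2 k
    by_cases hi : k ∈ e.symm i <;> by_cases hi' : k ∈ e.symm i' <;>
      simp only [hi, hi', not_true_eq_false, sg, if_true, if_false, LinearMap.neg_apply] at hk h₁ h₂
    · linarith
    · linarith
  · intro i y hy y' hy' t ht
    have hconv := convex_stdSimplex ℝ B
    have hself : ∀ z ∈ stdSimplex ℝ B, (fun a => ∑ b, z b * u a b) ∈ Phi u H z :=
      fun z hz => ⟨z, hz, fun _ _ => rfl, rfl⟩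
    ext W
    constructor
    · intro hW
      rcases ht.1.eq_or_lt with rfl | ht₀
      · exact ⟨_, hself y hy.1, W, by simpa using hW, by simp⟩
      rcases ht.2.eq_or_lt with rfl | ht₁
      · exact ⟨W, by simpa using hW, _, hself y' hy'.1, by simp⟩
      have hz := hconv hy.1 hy'.1 ht.1 (sub_nonneg.2 ht.2) (by ring)
      obtain ⟨x, hx, hxH, rfl⟩ := hW
      obtain ⟨hx₀, hxL⟩ := (hfib _ hz x).2 ⟨hx, hxH⟩
      obtain ⟨w, w', hw, hw', rfl⟩ := hg y y' (fun k => by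
        by_cases hk : g k = 0
        · simp [hk]
        have h₁ := hy.2 ⟨k, hk⟩
        have h₂ := hy'.2 ⟨k, hk⟩
        by_cases hi : (⟨k, hk⟩ : K) ∈ e.symm i <;>
          simp only [hi, sg, if_true, if_false, LinearMap.neg_apply, neg_nonneg] at h₁ h₂
        · exact .inl ⟨h₁, h₂⟩
        · exact .inr ⟨h₁, h₂⟩) t ht₀ ht₁ x hx₀ hxL
      rw [hfib y hy.1] at hw
      rw [hfib y' hy'.1] at hw'
      refine ⟨_, ⟨w, hw.1, hw.2, rfl⟩, _, ⟨w', hw'.1, hw'.2, rfl⟩, funext fun a => ?_⟩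
      simp [add_mul, Finset.sum_add_distrib, Finset.mul_sum, mul_assoc]
    · rintro ⟨_, ⟨w, hw, hwH, rfl⟩, _, ⟨w', hw', hwH', rfl⟩, rfl⟩
      refine ⟨t • w + (1 - t) • w', hconv hw hw' ht.1 (sub_nonneg.2 ht.2) (by ring),
        fun a j => ?_, funext fun a => ?_⟩
      · simp [add_mul, Finset.sum_add_distrib, mul_assoc, ← Finset.mul_sum, hwH, hwH']
      · simp [add_mul, Finset.sum_add_distrib, Finset.mul_sum, mul_assoc]
end

section
/- Let finite families (x_ℓ)_{ℓ∈𝓛} in 𝒳 and (y_k)_{k∈𝓚} in 𝒴 be such that for every y ∈ 𝒴 the set argmax_{x∈𝒳} inf_{U∈Φ(y)} ⟨x,U⟩ contains some x_ℓ and is contained in conv{x_ℓ : x_ℓ ∈ argmax_{x∈𝒳} inf_{U∈Φ(y)} ⟨x,U⟩}, and dually for player 2 with (y_k) and Ψ. Set Y_ℓ = {y ∈ 𝒴 : x_ℓ ∈ argmax_{x∈𝒳} inf_{U∈Φ(y)} ⟨x,U⟩} and X_k = {x ∈ 𝒳 : y_k ∈ argmax_{y∈𝒴} inf_{V∈Ψ(x)}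 ⟨y,V⟩}. If (𝐱,𝐲) ∈ Δ(𝓛)×Δ(𝓚) is fully labelled — that is, for every ℓ ∈ 𝓛 either 𝐱[ℓ] = 0 or Σ_k 𝐲[k] y_k ∈ Y_ℓ, and for every k ∈ 𝓚 either 𝐲[k] = 0 or Σ_ℓ 𝐱[ℓ] x_ℓ ∈ X_k — then the induced pair (x,y) = (Σ_ℓ 𝐱[ℓ] x_ℓ, Σ_k 𝐲[k] y_k) is a Nash equilibrium of the partial-monitoring game. -/
theorem bddBelow_payoff_image_Phi {A B : Type*} [Fintype A] [Fintype B] {d : ℕ} (u : A → B → ℝ)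
    (H : A → B → Fin d → ℝ) (y : B → ℝ) (x : A → ℝ) :
    BddBelow ((fun U : A → ℝ => ∑ i, x i * U i) '' Phi u H y) := by
  have hc : Continuous fun z : B → ℝ => ∑ i, x i * ∑ b, z b * u i b := by fun_prop
  refine ((isCompact_stdSimplex ℝ B).image hc).bddBelow.mono ?_
  rintro _ ⟨_, ⟨z, hz, -, rfl⟩, rfl⟩
  exact ⟨z, hz, rfl⟩

theorem concaveOn_inf1 {n : Type*} [Fintype n] {S : Set (n → ℝ)} (hS : S.Nonempty)
    (hb : ∀ x : n → ℝ, BddBelow ((fun U : n → ℝ => ∑ i, x i * U i) '' S)) :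
    ConcaveOn ℝ (stdSimplex ℝ n) (inf1 S) := by
  refine ⟨convex_stdSimplex ℝ n, fun x _ y _ a b ha hb' _ => ?_⟩
  refine le_csInf (hS.image _) ?_
  rintro _ ⟨U, hU, rfl⟩
  have h₁ : inf1 S x ≤ ∑ i, x i * U i := csInf_le (hb x) ⟨U, hU, rfl⟩
  have h₂ : inf1 S y ≤ ∑ i, y i * U i := csInf_le (hb y) ⟨U, hU, rfl⟩
  have h : ∑ i, (a • x + b • y) i * U i = a * ∑ i, x i * U i + b * ∑ i, y i * U i := by
    simp [Finset.mul_sum, ← Finset.sum_add_distrib, add_mul, mul_assoc]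
  simp only [smul_eq_mul, h]
  gcongr

theorem convex_BR1 {A B : Type*} [Fintype A] [Fintype B] {d : ℕ} (u : A → B → ℝ)
    (H : A → B → Fin d → ℝ) {y : B → ℝ} (hy : y ∈ stdSimplex ℝ B) : Convex ℝ (BR1 u H y) := by
  have hc : ConcaveOn ℝ (stdSimplex ℝ A) (inf1 (Phi u H y)) :=
    concaveOn_inf1 ⟨_, y, hy, fun _ _ => rfl, rfl⟩ (bddBelow_payoff_image_Phi u H y)
  intro x hx z hz a b ha hb hab
  exact ⟨hc.1 hx.1 hz.1 ha hb hab, fun x' hx' =>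
    (hc.convex_ge _ ⟨hx.1, hx.2 x' hx'⟩ ⟨hz.1, hz.2 x' hx'⟩ ha hb hab).2⟩

theorem convex_BR2 {A B : Type*} [Fintype A] [Fintype B] {e : ℕ} (v : A → B → ℝ)
    (M : A → B → Fin e → ℝ) {x : A → ℝ} (hx : x ∈ stdSimplex ℝ A) : Convex ℝ (BR2 v M x) :=
  convex_BR1 (fun b a => v a b) (fun b a => M a b) hx

theorem Convex.sum_smul_mem_of_eq_zero_or_mem {ι E : Type*} [Fintype ι] [AddCommGroup E]
    [Module ℝ E] {s : Set E} (hs : Convex ℝ s) {w : ι → ℝ} (hw : w ∈ stdSimplex ℝ ι) {z : ι → E}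
    (hz : ∀ i, w i = 0 ∨ z i ∈ s) : ∑ i, w i • z i ∈ s := by
  rw [← finsum_eq_sum_of_fintype]
  exact hs.finsum_mem hw.1 (by rw [finsum_eq_sum_of_fintype, hw.2])
    fun i hi => (hz i).resolve_left hi

/-- given finite families `(x_ℓ)`, `(y_k)` with the required best-reply
properties, and the regions `Y_ℓ = {y ∈ 𝒴 : x_ℓ ∈ argmax}` and `X_k = {x ∈ 𝒳 : y_k ∈ argmax}`,
every fully labelled point `(𝐱,𝐲) ∈ Δ(𝓛) × Δ(𝓚)` induces a Nash equilibrium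
`(Σ_ℓ 𝐱[ℓ]x_ℓ, Σ_k 𝐲[k]y_k)` of the partial-monitoring game. -/
theorem fully_labelled_induces_nash
    {A B L K : Type*} [Fintype A] [Fintype B] [Fintype L] [Fintype K] {d e : ℕ}
    (u v : A → B → ℝ) (H : A → B → Fin d → ℝ) (M : A → B → Fin e → ℝ)
    (xs : L → (A → ℝ)) (ys : K → (B → ℝ))
    (hxs : ∀ ℓ, xs ℓ ∈ stdSimplex ℝ A) (hys : ∀ k, ys k ∈ stdSimplex ℝ B)
    (hfam₁ : ∀ y ∈ stdSimplex ℝ B, (∃ ℓ, xs ℓ ∈ BR1 u H y) ∧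
      BR1 u H y ⊆ convexHull ℝ {x : A → ℝ | ∃ ℓ, x = xs ℓ ∧ xs ℓ ∈ BR1 u H y})
    (hfam₂ : ∀ x ∈ stdSimplex ℝ A, (∃ k, ys k ∈ BR2 v M x) ∧
      BR2 v M x ⊆ convexHull ℝ {y : B → ℝ | ∃ k, y = ys k ∧ ys k ∈ BR2 v M x})
    (X : L → ℝ) (Y : K → ℝ) (hX : X ∈ stdSimplex ℝ L) (hY : Y ∈ stdSimplex ℝ K)
    -- the point (X, Y) is fully labelled
    (hlab₁ : ∀ ℓ, X ℓ = 0 ∨ xs ℓ ∈ BR1 u H (∑ k, Y k • ys k))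
    (hlab₂ : ∀ k, Y k = 0 ∨ ys k ∈ BR2 v M (∑ ℓ, X ℓ • xs ℓ)) :
    (∑ ℓ, X ℓ • xs ℓ) ∈ BR1 u H (∑ k, Y k • ys k) ∧
    (∑ k, Y k • ys k) ∈ BR2 v M (∑ ℓ, X ℓ • xs ℓ) := by
  exact ⟨(convex_BR1 u H ((convex_stdSimplex ℝ B).sum_smul_mem_of_eq_zero_or_mem hY
      fun k => .inr (hys k))).sum_smul_mem_of_eq_zero_or_mem hX hlab₁,
    (convex_BR2 v M ((convex_stdSimplex ℝ A).sum_smul_mem_of_eq_zero_or_mem hX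
      fun ℓ => .inr (hxs ℓ))).sum_smul_mem_of_eq_zero_or_mem hY hlab₂⟩
end

section
/- Let finite families (x_ℓ)_{ℓ∈𝓛} in 𝒳 and (y_k)_{k∈𝓚} in 𝒴 be such that for every y ∈ 𝒴 the set argmax_{x∈𝒳} inf_{U∈Φ(y)} ⟨x,U⟩ contains some x_ℓ and is contained in conv{x_ℓ : x_ℓ ∈ argmax_{x∈𝒳} inf_{U∈Φ(y)} ⟨x,U⟩}, and dually for player 2 with (y_k) and Ψ. Set Y_ℓ = {y ∈ 𝒴 : x_ℓ ∈ argmax_{x∈𝒳} inf_{U∈Φ(y)} ⟨x,U⟩} and X_k = {x ∈ 𝒳 : y_k ∈ argmax_{y∈𝒴} inf_{V∈Ψ(x)} ⟨y,V⟩}. Then every Nash equilibrium (x,y) of the partial-monitoring game is induced by a fully labelled point: there exists (𝐱,𝐲) ∈ Δ(𝓛)×Δ(𝓚) with x = Σ_ℓ 𝐱[ℓ] x_ℓ and y = Σ_k 𝐲[k] y_k such that for every ℓ ∈ 𝓛 either 𝐱[ℓ] = 0 or y ∈ Y_ℓ, and for every k ∈ 𝓚 either 𝐲[k] = 0 or x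 ∈ X_k. -/
/-- A point of the convex hull of the members of a finite family that satisfy `p` is a convex
combination of the family whose weights vanish wherever `p` fails. -/
theorem exists_stdSimplex_of_mem_convexHull {ι E : Type*} [Fintype ι] [AddCommGroup E]
    [Module ℝ E] (f : ι → E) (p : ι → Prop) {x : E}
    (hx : x ∈ convexHull ℝ {z : E | ∃ i, z = f i ∧ p i}) :
    ∃ w ∈ stdSimplex ℝ ι, x = ∑ i, w i • f i ∧ ∀ i, w i = 0 ∨ p i := by
  classical
  let S : Set E := {z | ∃ w ∈ stdSimplex ℝ ι, z = ∑ i, w i • f i ∧ ∀ i, w i = 0 ∨ p i}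
  have hconv : Convex ℝ S := by
    rintro _ ⟨w, hw, rfl, hwp⟩ _ ⟨w', hw', rfl, hwp'⟩ a b ha hb hab
    refine ⟨a • w + b • w', convex_stdSimplex ℝ ι hw hw' ha hb hab, ?_, fun i => ?_⟩
    · simp [Finset.smul_sum, add_smul, mul_smul, Finset.sum_add_distrib]
    · rcases hwp i with h | h
      · rcases hwp' i with h' | h'
        · simp [h, h']
        · exact Or.inr h'
      · exact Or.inr h
  refine convexHull_min (t := S) ?_ hconv hx
  rintro _ ⟨i, rfl, hi⟩
  refine ⟨Pi.single i 1, single_mem_stdSimplex ℝ i, ?_, fun j => ?_⟩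
  · simp [Pi.single_apply, ite_smul]
  · by_cases h : j = i
    · exact Or.inr (h ▸ hi)
    · exact Or.inl (Pi.single_eq_of_ne h 1)


/-- given finite families `(x_ℓ)`, `(y_k)` with the required best-reply
properties, and the regions `Y_ℓ = {y ∈ 𝒴 : x_ℓ ∈ argmax}` and `X_k = {x ∈ 𝒳 : y_k ∈ argmax}`,
every Nash equilibrium `(x,y)` of the partial-monitoring game is induced by a fully labelled
point `(𝐱,𝐲) ∈ Δ(𝓛) × Δ(𝓚)`. -/
theorem nash_induced_by_fully_labelled
    {A B L K : Type*} [Fintype A] [Fintype B] [Fintype L] [Fintype K] {d e : ℕ}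
    (u v : A → B → ℝ) (H : A → B → Fin d → ℝ) (M : A → B → Fin e → ℝ)
    (xs : L → (A → ℝ)) (ys : K → (B → ℝ))
    (hxs : ∀ ℓ, xs ℓ ∈ stdSimplex ℝ A) (hys : ∀ k, ys k ∈ stdSimplex ℝ B)
    (hfam₁ : ∀ y ∈ stdSimplex ℝ B, (∃ ℓ, xs ℓ ∈ BR1 u H y) ∧
      BR1 u H y ⊆ convexHull ℝ {x : A → ℝ | ∃ ℓ, x = xs ℓ ∧ xs ℓ ∈ BR1 u H y})
    (hfam₂ : ∀ x ∈ stdSimplex ℝ A, (∃ k, ys k ∈ BR2 v M x) ∧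
      BR2 v M x ⊆ convexHull ℝ {y : B → ℝ | ∃ k, y = ys k ∧ ys k ∈ BR2 v M x})
    -- a Nash equilibrium of the partial-monitoring game
    (x : A → ℝ) (y : B → ℝ)
    (hNash₁ : x ∈ BR1 u H y) (hNash₂ : y ∈ BR2 v M x) :
    ∃ X ∈ stdSimplex ℝ L, ∃ Y ∈ stdSimplex ℝ K,
      x = ∑ ℓ, X ℓ • xs ℓ ∧ y = ∑ k, Y k • ys k ∧
      (∀ ℓ, X ℓ = 0 ∨ xs ℓ ∈ BR1 u H y) ∧
      (∀ k, Y k = 0 ∨ ys k ∈ BR2 v M x) := by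
  obtain ⟨X, hX, hxX, hXp⟩ := exists_stdSimplex_of_mem_convexHull xs (fun ℓ => xs ℓ ∈ BR1 u H y)
    ((hfam₁ y hNash₂.1).2 hNash₁)
  obtain ⟨Y, hY, hyY, hYp⟩ := exists_stdSimplex_of_mem_convexHull ys (fun k => ys k ∈ BR2 v M x)
    ((hfam₂ x hNash₁.1).2 hNash₂)
  exact ⟨X, hX, Y, hY, hxX, hyY, hXp, hYp⟩
end
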